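/- arXiv:1912.10697 — 2 statements merged into one kernel-verified Lean document; each statement's English description precedes it below -/
import Mathlib

section
/- Under assumptions (A1) and (A2), the Q-function is a viscosity solution of the HJB equation ∂_t Q + ∇_x Q · f(x, u) − M|∇_u Q| + r(x, u) = 0 with terminal condition Q(x, u, T) = q(x). That is: (1) Q(x, u, T) = q(x) for all (x, u); (2) for every R ∈ C¹(ℝ^n × ℝ^m × (0,T)), if Q − R has a local maximum at (x₀, u₀, t₀) then ∂_t R(x₀,u₀,t₀) + ∇_x R(x₀,u₀,t₀) · f(x₀,u₀) − M|∇_u R(x₀,u₀,t₀)| + r(x₀,u₀) ≥ 0; (3) for every R ∈ C¹(ℝ^n × ℝ^m × (0,T)), if Q − R has a local minimum at (x₀, u₀, t₀) then ∂_t R(x₀,u₀,t₀) + ∇_x R(x₀,u₀,t₀) · f(x₀,u₀) − M|∇_u R(x₀,u₀,t₀)| + r(x₀,u₀) ≤ 0. -/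
open MeasureTheory Set

noncomputable section

/-- Carathéodory solution of `ẋ(s) = f(x(s), u(s))` on `[t, T]`:
`x s = x t + ∫_t^s f(x(τ), u(τ)) dτ` (with the integrand interval integrable). -/
def IsTrajectory {n m : ℕ}
    (f : EuclideanSpace ℝ (Fin n) → EuclideanSpace ℝ (Fin m) → EuclideanSpace ℝ (Fin n))
    (t T : ℝ) (x : ℝ → EuclideanSpace ℝ (Fin n)) (u : ℝ → EuclideanSpace ℝ (Fin m)) : Prop :=
  ∀ s ∈ Set.Icc t T,
    IntervalIntegrable (fun τ => f (x τ) (u τ)) MeasureTheory.volume t s ∧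
      x s = x t + ∫ τ in t..s, f (x τ) (u τ)

/-- The total cost `∫_t^T r(x(s), u(s)) ds + q(x(T))`. -/
def cost {n m : ℕ}
    (r : EuclideanSpace ℝ (Fin n) → EuclideanSpace ℝ (Fin m) → ℝ)
    (q : EuclideanSpace ℝ (Fin n) → ℝ) (t T : ℝ)
    (x : ℝ → EuclideanSpace ℝ (Fin n)) (u : ℝ → EuclideanSpace ℝ (Fin m)) : ℝ :=
  (∫ s in t..T, r (x s) (u s)) + q (x T)

/-- Admissible controls `𝕌₁`: Lipschitz continuous on `[0, T]` with
Lipschitz constant (equivalently, `‖u̇‖_{L^∞}` bound) `M`. -/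
def Adm {m : ℕ} (M T : ℝ) (u : ℝ → EuclideanSpace ℝ (Fin m)) : Prop :=
  LipschitzOnWith (Real.toNNReal M) u (Set.Icc 0 T)

/-- The Q-function
`Q(x₀,u₀,t) = inf { ∫_t^T r(x(s),u(s)) ds + q(x(T)) : u ∈ 𝕌₁, x(t) = x₀, u(t) = u₀ }`. -/
def Qfun {n m : ℕ}
    (f : EuclideanSpace ℝ (Fin n) → EuclideanSpace ℝ (Fin m) → EuclideanSpace ℝ (Fin n))
    (r : EuclideanSpace ℝ (Fin n) → EuclideanSpace ℝ (Fin m) → ℝ)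
    (q : EuclideanSpace ℝ (Fin n) → ℝ) (M T : ℝ)
    (x₀ : EuclideanSpace ℝ (Fin n)) (u₀ : EuclideanSpace ℝ (Fin m)) (t : ℝ) : ℝ :=
  sInf { c : ℝ | ∃ x u, Adm M T u ∧ IsTrajectory f t T x u ∧
      x t = x₀ ∧ u t = u₀ ∧ c = cost r q t T x u }


open RealInnerProductSpace Filter Topology

/-- The HJB expression `∂_t R + ∇ₓR · f(x₀,u₀) − M |∇ᵤR| + r(x₀,u₀)` evaluated at
`(x₀, u₀, t₀)` for a test function `R`. -/
def hjbExpr {n m : ℕ}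
    (f : EuclideanSpace ℝ (Fin n) → EuclideanSpace ℝ (Fin m) → EuclideanSpace ℝ (Fin n))
    (r : EuclideanSpace ℝ (Fin n) → EuclideanSpace ℝ (Fin m) → ℝ) (M : ℝ)
    (R : EuclideanSpace ℝ (Fin n) × EuclideanSpace ℝ (Fin m) × ℝ → ℝ)
    (x₀ : EuclideanSpace ℝ (Fin n)) (u₀ : EuclideanSpace ℝ (Fin m)) (t₀ : ℝ) : ℝ :=
  deriv (fun s => R (x₀, u₀, s)) t₀ +
    ⟪gradient (fun x => R (x, u₀, t₀)) x₀, f x₀ u₀⟫ -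
    M * ‖gradient (fun u => R (x₀, u, t₀)) u₀‖ + r x₀ u₀

/-- `Q` is a viscosity solution of
`∂_t Q + ∇ₓQ · f(x,u) − M|∇ᵤQ| + r(x,u) = 0`, `Q(x,u,T) = q(x)`:
(1) terminal condition; (2) subsolution property at local maxima of `Q − R` for `C¹` test
functions `R`; (3) supersolution property at local minima. -/
def IsViscositySolution {n m : ℕ}
    (f : EuclideanSpace ℝ (Fin n) → EuclideanSpace ℝ (Fin m) → EuclideanSpace ℝ (Fin n))
    (r : EuclideanSpace ℝ (Fin n) → EuclideanSpace ℝ (Fin m) → ℝ)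
    (q : EuclideanSpace ℝ (Fin n) → ℝ) (M T : ℝ)
    (Q : EuclideanSpace ℝ (Fin n) × EuclideanSpace ℝ (Fin m) × ℝ → ℝ) : Prop :=
  ContinuousOn Q (Set.univ ×ˢ Set.univ ×ˢ Set.Icc 0 T) ∧
  (∀ x u, Q (x, u, T) = q x) ∧
  (∀ R : EuclideanSpace ℝ (Fin n) × EuclideanSpace ℝ (Fin m) × ℝ → ℝ,
    ContDiffOn ℝ 1 R (Set.univ ×ˢ Set.univ ×ˢ Set.Ioo 0 T) →
    ∀ x₀ u₀ t₀, t₀ ∈ Set.Ioo 0 T →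
      IsLocalMaxOn (fun p => Q p - R p) (Set.univ ×ˢ Set.univ ×ˢ Set.Ioo 0 T) (x₀, u₀, t₀) →
      0 ≤ hjbExpr f r M R x₀ u₀ t₀) ∧
  (∀ R : EuclideanSpace ℝ (Fin n) × EuclideanSpace ℝ (Fin m) × ℝ → ℝ,
    ContDiffOn ℝ 1 R (Set.univ ×ˢ Set.univ ×ˢ Set.Ioo 0 T) →
    ∀ x₀ u₀ t₀, t₀ ∈ Set.Ioo 0 T →
      IsLocalMinOn (fun p => Q p - R p) (Set.univ ×ˢ Set.univ ×ˢ Set.Ioo 0 T) (x₀, u₀, t₀) →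
      hjbExpr f r M R x₀ u₀ t₀ ≤ 0)

section Trajectories

variable {n m : ℕ}
  {f : EuclideanSpace ℝ (Fin n) → EuclideanSpace ℝ (Fin m) → EuclideanSpace ℝ (Fin n)}
  {r : EuclideanSpace ℝ (Fin n) → EuclideanSpace ℝ (Fin m) → ℝ}
  {q : EuclideanSpace ℝ (Fin n) → ℝ} {M T t t' : ℝ} {Cf Cr Cq : ℝ} {Kf Kr Kq : NNReal}
  {x y : ℝ → EuclideanSpace ℝ (Fin n)} {u v : ℝ → EuclideanSpace ℝ (Fin m)}
  {G : Type*} [NormedAddCommGroup G] {K : NNReal}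
  {g : EuclideanSpace ℝ (Fin n) → EuclideanSpace ℝ (Fin m) → G}

theorem Adm.norm_sub_le (hu : Adm M T u) (hM : 0 ≤ M) {s s' : ℝ} (hs : s ∈ Icc 0 T)
    (hs' : s' ∈ Icc 0 T) : ‖u s - u s'‖ ≤ M * |s - s'| := by
  have := hu.dist_le_mul s hs s' hs'
  rwa [dist_eq_norm, Real.coe_toNNReal _ hM, Real.dist_eq] at this

theorem adm_of_norm_sub_le (hM : 0 ≤ M)
    (h : ∀ s ∈ Icc 0 T, ∀ s' ∈ Icc 0 T, s ≤ s' → ‖u s' - u s‖ ≤ M * (s' - s)) : Adm M T u := by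
  refine LipschitzOnWith.of_dist_le_mul fun s hs s' hs' => ?_
  rw [Real.coe_toNNReal _ hM, Real.dist_eq, dist_eq_norm]
  rcases le_total s s' with hss | hss
  · rw [norm_sub_rev, abs_sub_comm, abs_of_nonneg (sub_nonneg.2 hss)]
    exact h s hs s' hs' hss
  · rw [abs_of_nonneg (sub_nonneg.2 hss)]
    exact h s' hs' s hs hss

/-- A Lipschitz estimate on `ℝ` may be checked separately to the left and to the right of a
point. -/
theorem norm_sub_le_of_split {a b M : ℝ} {u : ℝ → G}
    (hl : ∀ s s', a ≤ s → s ≤ s' → s' ≤ t' → ‖u s' - u s‖ ≤ M * (s' - s))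
    (hr : ∀ s s', t' ≤ s → s ≤ s' → s' ≤ b → ‖u s' - u s‖ ≤ M * (s' - s))
    {s s' : ℝ} (hs : a ≤ s) (hss : s ≤ s') (hs' : s' ≤ b) : ‖u s' - u s‖ ≤ M * (s' - s) := by
  rcases le_total s' t' with h | h
  · exact hl s s' hs hss h
  rcases le_total t' s with h1 | h1
  · exact hr s s' h1 hss hs'
  calc ‖u s' - u s‖ ≤ ‖u s' - u t'‖ + ‖u t' - u s‖ := norm_sub_le_norm_sub_add_norm_sub ..
    _ ≤ M * (s' - t') + M * (t' - s) := add_le_add (hr _ _ le_rfl h hs') (hl _ _ hs h1 le_rfl)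
    _ = M * (s' - s) := by ring

theorem LipschitzWith.norm_sub_le_max
    (hg : LipschitzWith K
      (fun p : EuclideanSpace ℝ (Fin n) × EuclideanSpace ℝ (Fin m) => g p.1 p.2))
    (x₁ x₂ : EuclideanSpace ℝ (Fin n)) (u₁ u₂ : EuclideanSpace ℝ (Fin m)) :
    ‖g x₁ u₁ - g x₂ u₂‖ ≤ K * max ‖x₁ - x₂‖ ‖u₁ - u₂‖ := by
  have := hg.dist_le_mul (x₁, u₁) (x₂, u₂)
  rwa [dist_eq_norm, Prod.dist_eq, dist_eq_norm, dist_eq_norm] at this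

theorem IsTrajectory.intervalIntegrable (hx : IsTrajectory f t T x u) {s s' : ℝ}
    (hs : s ∈ Icc t T) (hs' : s' ∈ Icc t T) :
    IntervalIntegrable (fun τ => f (x τ) (u τ)) volume s s' :=
  (hx s hs).1.symm.trans (hx s' hs').1

theorem IsTrajectory.sub_eq_integral (hx : IsTrajectory f t T x u) {s s' : ℝ}
    (hs : s ∈ Icc t T) (hs' : s' ∈ Icc t T) :
    x s' - x s = ∫ τ in s..s', f (x τ) (u τ) := by
  rw [(hx s hs).2, (hx s' hs').2, add_sub_add_left_eq_sub]
  exact intervalIntegral.integral_interval_sub_left (hx s' hs').1 (hx s hs).1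

theorem IsTrajectory.mono_left (hx : IsTrajectory f t T x u) (ht : t' ∈ Icc t T) :
    IsTrajectory f t' T x u := by
  intro s hs
  have hs' : s ∈ Icc t T := ⟨ht.1.trans hs.1, hs.2⟩
  exact ⟨hx.intervalIntegrable ht hs', by rw [← hx.sub_eq_integral ht hs']; abel⟩

theorem IsTrajectory.norm_sub_le (hx : IsTrajectory f t T x u) (hfb : ∀ x u, ‖f x u‖ ≤ Cf)
    {s s' : ℝ} (hs : s ∈ Icc t T) (hs' : s' ∈ Icc t T) : ‖x s' - x s‖ ≤ Cf * |s' - s| := by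
  rw [hx.sub_eq_integral hs hs']
  exact intervalIntegral.norm_integral_le_of_norm_le_const fun τ _ => hfb _ _

theorem IsTrajectory.continuousOn (hx : IsTrajectory f t T x u) (hfb : ∀ x u, ‖f x u‖ ≤ Cf) :
    ContinuousOn x (Icc t T) := by
  have hC : 0 ≤ Cf := (norm_nonneg _).trans (hfb 0 0)
  refine (LipschitzOnWith.of_dist_le_mul (K := Cf.toNNReal) fun s hs s' hs' => ?_).continuousOn
  rw [dist_eq_norm, Real.coe_toNNReal _ hC, Real.dist_eq]
  exact hx.norm_sub_le hfb hs' hs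

theorem ContinuousOn.comp_pair (hg : LipschitzWith K
      (fun p : EuclideanSpace ℝ (Fin n) × EuclideanSpace ℝ (Fin m) => g p.1 p.2))
    {S : Set ℝ} (hx : ContinuousOn x S) (hu : ContinuousOn u S) :
    ContinuousOn (fun τ => g (x τ) (u τ)) S :=
  hg.continuous.comp_continuousOn (hx.prodMk hu)

/-- First order expansion of running integrals along trajectories, uniform in the control. -/
theorem IsTrajectory.norm_integral_sub_le [NormedSpace ℝ G] [CompleteSpace G]
    (hx : IsTrajectory f t T x u) (hu : Adm M T u) (hM : 0 ≤ M) (ht : 0 ≤ t)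
    (hfb : ∀ x u, ‖f x u‖ ≤ Cf)
    (hg : LipschitzWith K
      (fun p : EuclideanSpace ℝ (Fin n) × EuclideanSpace ℝ (Fin m) => g p.1 p.2))
    (ht' : t' ∈ Icc t T) :
    ‖(∫ τ in t..t', g (x τ) (u τ)) - (t' - t) • g (x t) (u t)‖ ≤
      K * (Cf + M) * (t' - t) * (t' - t) := by
  have hC : 0 ≤ Cf := (norm_nonneg _).trans (hfb 0 0)
  have htT : t ∈ Icc t T := ⟨le_rfl, ht'.1.trans ht'.2⟩
  have hsub : Icc t t' ⊆ Icc t T := Icc_subset_Icc_right ht'.2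
  have hcont : ContinuousOn (fun τ => g (x τ) (u τ)) (uIcc t t') := by
    rw [uIcc_of_le ht'.1]
    exact ((hx.continuousOn hfb).mono hsub).comp_pair hg
      (hu.continuousOn.mono (hsub.trans (Icc_subset_Icc_left ht)))
  rw [← intervalIntegral.integral_const,
    ← intervalIntegral.integral_sub hcont.intervalIntegrable intervalIntegrable_const]
  refine (intervalIntegral.norm_integral_le_of_norm_le_const
    (C := K * (Cf + M) * (t' - t)) fun s hs => ?_).trans_eq
      (by rw [abs_of_nonneg (sub_nonneg.2 ht'.1)])
  rw [uIoc_of_le ht'.1] at hs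
  have hsT : s ∈ Icc t T := ⟨hs.1.le, hs.2.trans ht'.2⟩
  have h1 := hx.norm_sub_le hfb htT hsT
  have h2 := hu.norm_sub_le hM (s := s) (s' := t) ⟨ht.trans hsT.1, hsT.2⟩ ⟨ht, htT.2⟩
  rw [abs_of_nonneg (sub_nonneg.2 hsT.1)] at h1 h2
  refine (hg.norm_sub_le_max _ _ _ _).trans ?_
  rw [mul_assoc]
  gcongr
  have h3 : s - t ≤ t' - t := sub_le_sub_right hs.2 t
  have h4 : 0 ≤ s - t := sub_nonneg.2 hsT.1
  refine max_le (h1.trans ?_) (h2.trans ?_) <;> nlinarith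

theorem exists_isTrajectory (hfb : ∀ x u, ‖f x u‖ ≤ Cf)
    (hfl : LipschitzWith Kf
      (fun p : EuclideanSpace ℝ (Fin n) × EuclideanSpace ℝ (Fin m) => f p.1 p.2))
    (htT : t ≤ T) (hu : ContinuousOn u (Icc t T)) (x₀ : EuclideanSpace ℝ (Fin n)) :
    ∃ x, x t = x₀ ∧ IsTrajectory f t T x u := by
  have hC : 0 ≤ Cf := (norm_nonneg _).trans (hfb 0 0)
  have hTt : 0 ≤ T - t := sub_nonneg.2 htT
  have hPL : IsPicardLindelof (fun s z => f z (u s)) (⟨t, le_rfl, htT⟩ : Icc t T) x₀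
      (Cf * (T - t)).toNNReal 0 Cf.toNNReal Kf :=
    { lipschitzOnWith := fun s _ => LipschitzWith.lipschitzOnWith <|
        LipschitzWith.of_dist_le_mul fun z z' => by
          simpa [dist_eq_norm] using hfl.norm_sub_le_max z z' (u s) (u s)
      continuousOn := fun z _ => ContinuousOn.comp_pair hfl continuousOn_const hu
      norm_le := fun s _ z _ => by rw [Real.coe_toNNReal _ hC]; exact hfb _ _
      mul_max_le := by
        rw [Real.coe_toNNReal _ hC, Real.coe_toNNReal _ (mul_nonneg hC hTt)]
        simp [hTt] }
  obtain ⟨x, hx0, hx⟩ := hPL.exists_eq_forall_mem_Icc_hasDerivWithinAt₀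
  refine ⟨x, hx0, fun s hs => ?_⟩
  have hcx : ContinuousOn x (Icc t T) := fun s hs => (hx s hs).continuousWithinAt
  have hsub : Icc t s ⊆ Icc t T := Icc_subset_Icc_right hs.2
  have hint : IntervalIntegrable (fun τ => f (x τ) (u τ)) volume t s := by
    refine ContinuousOn.intervalIntegrable ?_
    rw [uIcc_of_le hs.1]
    exact (hcx.mono hsub).comp_pair hfl (hu.mono hsub)
  refine ⟨hint, ?_⟩
  rw [intervalIntegral.integral_eq_sub_of_hasDerivAt_of_le hs.1 (hcx.mono hsub)
    (fun τ hτ => ?_) hint]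
  · abel
  · exact (hx τ ⟨hτ.1.le, hτ.2.le.trans hs.2⟩).hasDerivAt
      (Icc_mem_nhds hτ.1 (hτ.2.trans_le hs.2))

theorem IsTrajectory.hasDerivWithinAt (hx : IsTrajectory f t T x u) (hfb : ∀ x u, ‖f x u‖ ≤ Cf)
    (hfl : LipschitzWith Kf
      (fun p : EuclideanSpace ℝ (Fin n) × EuclideanSpace ℝ (Fin m) => f p.1 p.2))
    (hu : ContinuousOn u (Icc t T)) {s : ℝ} (hs : s ∈ Ico t T) :
    HasDerivWithinAt x (f (x s) (u s)) (Ici s) s := by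
  have hsT : s ∈ Icc t T := Ico_subset_Icc_self hs
  have hmem : Icc t T ∈ 𝓝[>] s := mem_of_superset (Ioo_mem_nhdsGT hs.2)
    fun z hz => ⟨hs.1.trans hz.1.le, hz.2.le⟩
  have hcont := (hx.continuousOn hfb).comp_pair hfl hu
  have hd : HasDerivWithinAt (fun s' => x t + ∫ τ in t..s', f (x τ) (u τ)) (f (x s) (u s))
      (Ici s) s := by
    refine (intervalIntegral.integral_hasDerivWithinAt_right (hx s hsT).1
      (t := Ioi s) ?_ ?_).const_add _
    · exact ⟨Icc t T, hmem, hcont.aestronglyMeasurable measurableSet_Icc⟩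
    · exact (hcont s hsT).mono_of_mem_nhdsWithin hmem
  refine hd.congr_of_eventuallyEq_of_mem ?_ self_mem_Ici
  filter_upwards [Ico_mem_nhdsGE hs.2] with z hz
  exact (hx z ⟨hs.1.trans hz.1, hz.2.le⟩).2

/-- Grönwall stability of trajectories with respect to initial state and control. -/
theorem IsTrajectory.norm_sub_le_of_close (hx : IsTrajectory f t T x u)
    (hy : IsTrajectory f t T y v) (hfb : ∀ x u, ‖f x u‖ ≤ Cf)
    (hfl : LipschitzWith Kf
      (fun p : EuclideanSpace ℝ (Fin n) × EuclideanSpace ℝ (Fin m) => f p.1 p.2))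
    (ht : 0 ≤ t) (hu : ContinuousOn u (Icc t T)) (hv : ContinuousOn v (Icc t T)) {δ : ℝ}
    (hxy : ‖x t - y t‖ ≤ δ) (huv : ∀ s ∈ Icc t T, ‖u s - v s‖ ≤ δ) {s : ℝ} (hs : s ∈ Icc t T) :
    ‖x s - y s‖ ≤ 2 * Real.exp ((Kf + 1) * T) * δ := by
  have hδ : 0 ≤ δ := (norm_nonneg _).trans hxy
  have hK : (0 : ℝ) < Kf + 1 := by positivity
  have key := dist_le_of_approx_trajectories_ODE (K := Kf + 1) (δ := δ) (εf := 0) (εg := Kf * δ)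
    (v := fun s z => f z (u s)) (f := x) (g := y) (a := t) (b := T)
    (f' := fun s => f (x s) (u s)) (g' := fun s => f (y s) (v s))
    (fun s => LipschitzWith.of_dist_le_mul fun z z' => by
      have h := hfl.norm_sub_le_max z z' (u s) (u s)
      rw [sub_self, norm_zero, max_eq_left (norm_nonneg _)] at h
      rw [dist_eq_norm, dist_eq_norm]
      refine h.trans ?_
      gcongr
      simp)
    (hx.continuousOn hfb) (fun s hs => hx.hasDerivWithinAt hfb hfl hu hs) (fun s _ => by simp)
    (hy.continuousOn hfb) (fun s hs => hy.hasDerivWithinAt hfb hfl hv hs)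
    (fun s hs => by
      have h := hfl.norm_sub_le_max (y s) (y s) (v s) (u s)
      rw [sub_self, norm_zero, max_eq_right (norm_nonneg _), norm_sub_rev (v s)] at h
      rw [dist_eq_norm]
      refine h.trans ?_
      gcongr
      exact huv s (Ico_subset_Icc_self hs))
    (by rwa [dist_eq_norm]) s hs
  rw [dist_eq_norm] at key
  refine key.trans ?_
  push_cast
  rw [gronwallBound_of_K_ne_0 hK.ne', zero_add]
  have hexp : Real.exp ((Kf + 1) * (s - t)) ≤ Real.exp ((Kf + 1) * T) := by
    gcongr; linarith [hs.2]
  have hexp0 := Real.exp_pos ((Kf + 1) * (s - t))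
  have hq : Kf * δ / (Kf + 1 : ℝ) ≤ δ := by
    rw [div_le_iff₀ hK]; nlinarith
  have hq0 : 0 ≤ Kf * δ / (Kf + 1 : ℝ) := by positivity
  calc δ * Real.exp ((Kf + 1) * (s - t)) +
        Kf * δ / (Kf + 1 : ℝ) * (Real.exp ((Kf + 1) * (s - t)) - 1)
      ≤ δ * Real.exp ((Kf + 1) * (s - t)) + δ * Real.exp ((Kf + 1) * (s - t)) := by nlinarith
    _ ≤ 2 * Real.exp ((Kf + 1) * T) * δ := by nlinarith

theorem IsTrajectory.congr {a b : ℝ} (hx : IsTrajectory f a b x u)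
    (hxy : EqOn x y (Icc a b)) (huv : EqOn u v (Icc a b)) : IsTrajectory f a b y v := by
  intro s hs
  have hsub : uIcc a s ⊆ Icc a b := by
    rw [uIcc_of_le hs.1]; exact Icc_subset_Icc_right hs.2
  have heq : EqOn (fun τ => f (x τ) (u τ)) (fun τ => f (y τ) (v τ)) (uIcc a s) := fun τ hτ => by
    simp only [hxy (hsub hτ), huv (hsub hτ)]
  obtain ⟨h1, h2⟩ := hx s hs
  refine ⟨h1.congr (heq.mono uIoc_subset_uIcc), ?_⟩
  rw [← hxy hs, ← hxy ⟨le_rfl, hs.1.trans hs.2⟩, h2, intervalIntegral.integral_congr heq]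

theorem IsTrajectory.mono_right {a b c : ℝ} (hx : IsTrajectory f a b x u) (hcb : c ≤ b) :
    IsTrajectory f a c x u :=
  fun s hs => hx s ⟨hs.1, hs.2.trans hcb⟩

theorem IsTrajectory.trans {a b c : ℝ} (hab : IsTrajectory f a b x u)
    (hbc : IsTrajectory f b c x u) (h : a ≤ b) : IsTrajectory f a c x u := by
  intro s hs
  rcases le_total s b with hsb | hsb
  · exact hab s ⟨hs.1, hsb⟩
  · obtain ⟨i1, e1⟩ := hab b ⟨h, le_rfl⟩
    obtain ⟨i2, e2⟩ := hbc s ⟨hsb, hs.2⟩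
    refine ⟨i1.trans i2, ?_⟩
    rw [e2, e1, add_assoc, intervalIntegral.integral_add_adjacent_intervals i1 i2]

theorem adm_line (hM : 0 ≤ M) (u₀ w : EuclideanSpace ℝ (Fin m)) (hw : ‖w‖ ≤ M) :
    Adm M T (fun s => u₀ + (s - t) • w) := by
  refine adm_of_norm_sub_le hM fun s _ s' _ hss => ?_
  rw [add_sub_add_left_eq_sub, ← sub_smul, norm_smul, Real.norm_eq_abs, sub_sub_sub_cancel_right,
    abs_of_nonneg (sub_nonneg.2 hss), mul_comm]
  gcongr

/-- Switching at time `t'` to another admissible pair with the same state and control. -/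
theorem exists_glue (hM : 0 ≤ M) (ht : 0 ≤ t) (ht' : t' ∈ Icc t T)
    (hu : Adm M T u) (hx : IsTrajectory f t T x u)
    (hv : Adm M T v) (hy : IsTrajectory f t' T y v) (hxy : y t' = x t') (huv : v t' = u t') :
    ∃ z w, Adm M T w ∧ IsTrajectory f t T z w ∧ EqOn x z (Icc t t') ∧ EqOn u w (Icc t t') ∧
      EqOn y z (Icc t' T) ∧ EqOn v w (Icc t' T) := by
  have hl : ∀ {α : Type _} (a b : ℝ → α), EqOn a (fun s => if s ≤ t' then a s else b s)
      (Iic t') := fun a b s hs => (if_pos hs).symm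
  have hr : ∀ {α : Type _} (a b : ℝ → α), b t' = a t' →
      EqOn b (fun s => if s ≤ t' then a s else b s) (Ici t') := by
    intro α a b hab s hs
    rcases eq_or_lt_of_le (show t' ≤ s from hs) with rfl | h
    · simp [hab]
    · exact (if_neg h.not_ge).symm
  have hxl := (hl x y).mono (Icc_subset_Iic_self (a := t))
  have hul := (hl u v).mono (Icc_subset_Iic_self (a := t))
  have hyr : EqOn y _ (Icc t' T) := fun s hs => hr x y hxy hs.1
  have hvr : EqOn v _ (Icc t' T) := fun s hs => hr u v huv hs.1
  refine ⟨_, _, ?_, ((hx.mono_right ht'.2).congr hxl hul).trans (hy.congr hyr hvr) ht'.1,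
    hxl, hul, hyr, hvr⟩
  refine adm_of_norm_sub_le hM fun s hs s' hs' hss => ?_
  refine norm_sub_le_of_split (a := 0) (b := T) (t' := t')
    (u := fun s => if s ≤ t' then u s else v s) ?_ ?_ hs.1 hss hs'.2
  · intro s s' h0 h1 h2
    have := hu.norm_sub_le hM ⟨h0.trans h1, h2.trans ht'.2⟩ ⟨h0, (h1.trans h2).trans ht'.2⟩
    rwa [abs_of_nonneg (sub_nonneg.2 h1), hl u v h2, hl u v (h1.trans h2)] at this
  · intro s s' h0 h1 h2
    have ht0 := ht.trans ht'.1
    have := hv.norm_sub_le hM ⟨ht0.trans (h0.trans h1), h2⟩ ⟨ht0.trans h0, h1.trans h2⟩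
    rwa [abs_of_nonneg (sub_nonneg.2 h1), hr u v huv (h0.trans h1), hr u v huv h0] at this

end Trajectories

/-- Boundedness and Lipschitz continuity of the dynamics `f`, running cost `r` and terminal
cost `q`, with explicit constants. -/
structure IsBoundedLipschitz {n m : ℕ}
    (f : EuclideanSpace ℝ (Fin n) → EuclideanSpace ℝ (Fin m) → EuclideanSpace ℝ (Fin n))
    (r : EuclideanSpace ℝ (Fin n) → EuclideanSpace ℝ (Fin m) → ℝ)
    (q : EuclideanSpace ℝ (Fin n) → ℝ) (Cf Cr Cq : ℝ) (Kf Kr Kq : NNReal) : Prop where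
  norm_f_le : ∀ x u, ‖f x u‖ ≤ Cf
  abs_r_le : ∀ x u, |r x u| ≤ Cr
  abs_q_le : ∀ x, |q x| ≤ Cq
  lipschitz_f : LipschitzWith Kf
    (fun p : EuclideanSpace ℝ (Fin n) × EuclideanSpace ℝ (Fin m) => f p.1 p.2)
  lipschitz_r : LipschitzWith Kr
    (fun p : EuclideanSpace ℝ (Fin n) × EuclideanSpace ℝ (Fin m) => r p.1 p.2)
  lipschitz_q : LipschitzWith Kq q

namespace IsBoundedLipschitz

variable {n m : ℕ}
  {f : EuclideanSpace ℝ (Fin n) → EuclideanSpace ℝ (Fin m) → EuclideanSpace ℝ (Fin n)}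
  {r : EuclideanSpace ℝ (Fin n) → EuclideanSpace ℝ (Fin m) → ℝ}
  {q : EuclideanSpace ℝ (Fin n) → ℝ} {M T t t' : ℝ} {Cf Cr Cq : ℝ} {Kf Kr Kq : NNReal}
  {x y : ℝ → EuclideanSpace ℝ (Fin n)} {u v : ℝ → EuclideanSpace ℝ (Fin m)}

theorem nonneg_Cf (H : IsBoundedLipschitz f r q Cf Cr Cq Kf Kr Kq) : 0 ≤ Cf :=
  (norm_nonneg _).trans (H.norm_f_le 0 0)

theorem nonneg_Cr (H : IsBoundedLipschitz f r q Cf Cr Cq Kf Kr Kq) : 0 ≤ Cr :=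
  (abs_nonneg _).trans (H.abs_r_le 0 0)

theorem intervalIntegrable_r (H : IsBoundedLipschitz f r q Cf Cr Cq Kf Kr Kq) (ht : 0 ≤ t)
    (hu : Adm M T u) (hx : IsTrajectory f t T x u) {s s' : ℝ}
    (hs : s ∈ Icc t T) (hs' : s' ∈ Icc t T) :
    IntervalIntegrable (fun τ => r (x τ) (u τ)) volume s s' :=
  (((hx.continuousOn H.norm_f_le).comp_pair H.lipschitz_r
    (hu.continuousOn.mono (Icc_subset_Icc_left ht))).mono
      (uIcc_subset_Icc hs hs')).intervalIntegrable

theorem cost_eq_add (H : IsBoundedLipschitz f r q Cf Cr Cq Kf Kr Kq) (ht : 0 ≤ t)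
    (hu : Adm M T u) (hx : IsTrajectory f t T x u) (ht' : t' ∈ Icc t T) :
    cost r q t T x u = (∫ s in t..t', r (x s) (u s)) + cost r q t' T x u := by
  have htT := ht'.1.trans ht'.2
  rw [cost, cost, ← add_assoc, intervalIntegral.integral_add_adjacent_intervals
    (H.intervalIntegrable_r ht hu hx ⟨le_rfl, htT⟩ ht')
    (H.intervalIntegrable_r ht hu hx ht' ⟨htT, le_rfl⟩)]

theorem abs_integral_r_le (H : IsBoundedLipschitz f r q Cf Cr Cq Kf Kr Kq) (h : t ≤ t') :
    |∫ s in t..t', r (x s) (u s)| ≤ Cr * (t' - t) := by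
  have := intervalIntegral.norm_integral_le_of_norm_le_const (a := t) (b := t')
    (f := fun s => r (x s) (u s)) (C := Cr) fun s _ => H.abs_r_le _ _
  rwa [Real.norm_eq_abs, abs_of_nonneg (sub_nonneg.2 h)] at this

theorem bddBelow_cost (H : IsBoundedLipschitz f r q Cf Cr Cq Kf Kr Kq) (htT : t ≤ T)
    (x₀ : EuclideanSpace ℝ (Fin n)) (u₀ : EuclideanSpace ℝ (Fin m)) :
    BddBelow { c : ℝ | ∃ x u, Adm M T u ∧ IsTrajectory f t T x u ∧
      x t = x₀ ∧ u t = u₀ ∧ c = cost r q t T x u } := by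
  refine ⟨-(Cr * (T - t) + Cq), ?_⟩
  rintro _ ⟨x, u, -, -, -, -, rfl⟩
  have h1 := abs_le.1 (H.abs_integral_r_le (x := x) (u := u) htT)
  have h2 := abs_le.1 (H.abs_q_le (x T))
  rw [cost]
  linarith [h1.1, h2.1]

theorem Qfun_le_cost (H : IsBoundedLipschitz f r q Cf Cr Cq Kf Kr Kq) (htT : t ≤ T)
    (hu : Adm M T u) (hx : IsTrajectory f t T x u) :
    Qfun f r q M T (x t) (u t) t ≤ cost r q t T x u :=
  csInf_le (H.bddBelow_cost htT _ _) ⟨x, u, hu, hx, rfl, rfl, rfl⟩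

theorem exists_line (H : IsBoundedLipschitz f r q Cf Cr Cq Kf Kr Kq) (htT : t ≤ T)
    (hM : 0 ≤ M) (x₀ : EuclideanSpace ℝ (Fin n)) (u₀ w : EuclideanSpace ℝ (Fin m))
    (hw : ‖w‖ ≤ M) :
    ∃ x u, Adm M T u ∧ IsTrajectory f t T x u ∧ x t = x₀ ∧ u t = u₀ ∧
      ∀ s, u s = u₀ + (s - t) • w := by
  obtain ⟨x, hx0, hx⟩ := exists_isTrajectory (u := fun s => u₀ + (s - t) • w) H.norm_f_le
    H.lipschitz_f htT (by fun_prop) x₀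
  exact ⟨x, _, adm_line hM u₀ w hw, hx, hx0, by simp, fun s => rfl⟩

theorem exists_cost_lt (H : IsBoundedLipschitz f r q Cf Cr Cq Kf Kr Kq) (htT : t ≤ T)
    (hM : 0 ≤ M) (x₀ : EuclideanSpace ℝ (Fin n)) (u₀ : EuclideanSpace ℝ (Fin m))
    {ε : ℝ} (hε : 0 < ε) :
    ∃ x u, Adm M T u ∧ IsTrajectory f t T x u ∧ x t = x₀ ∧ u t = u₀ ∧
      cost r q t T x u < Qfun f r q M T x₀ u₀ t + ε := by
  obtain ⟨x, u, hu, hx, hx0, hu0, -⟩ := H.exists_line htT hM x₀ u₀ 0 (by simpa)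
  obtain ⟨_, ⟨y, v, hv, hy, hy0, hv0, rfl⟩, hlt⟩ :=
    Real.lt_sInf_add_pos (s := { c : ℝ | ∃ x u, Adm M T u ∧ IsTrajectory f t T x u ∧
      x t = x₀ ∧ u t = u₀ ∧ c = cost r q t T x u }) ⟨_, x, u, hu, hx, hx0, hu0, rfl⟩ hε
  exact ⟨y, v, hv, hy, hy0, hv0, hlt⟩

/-- One half of the dynamic programming principle. -/
theorem Qfun_le_integral_add (H : IsBoundedLipschitz f r q Cf Cr Cq Kf Kr Kq) (hM : 0 ≤ M)
    (ht : 0 ≤ t) (ht' : t' ∈ Icc t T) (hu : Adm M T u) (hx : IsTrajectory f t T x u) :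
    Qfun f r q M T (x t) (u t) t ≤
      (∫ s in t..t', r (x s) (u s)) + Qfun f r q M T (x t') (u t') t' := by
  refine le_of_forall_pos_le_add fun ε hε => ?_
  obtain ⟨y, v, hv, hy, hy0, hv0, hlt⟩ := H.exists_cost_lt (M := M) ht'.2 hM (x t') (u t') hε
  obtain ⟨z, w, hw, hz, hxz, huw, hyz, hvw⟩ := exists_glue hM ht ht' hu hx hv hy hy0 hv0
  have h0 : t ∈ Icc t t' := ⟨le_rfl, ht'.1⟩
  have hle := H.Qfun_le_cost (ht'.1.trans ht'.2) hw hz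
  rw [← hxz h0, ← huw h0, H.cost_eq_add ht hw hz ht'] at hle
  have e1 : ∫ s in t..t', r (z s) (w s) = ∫ s in t..t', r (x s) (u s) := by
    refine intervalIntegral.integral_congr fun s hs => ?_
    rw [uIcc_of_le ht'.1] at hs
    simp only [hxz hs, huw hs]
  have e2 : cost r q t' T z w = cost r q t' T y v := by
    rw [cost, cost, ← hyz ⟨ht'.2, le_rfl⟩]
    congr 1
    refine intervalIntegral.integral_congr fun s hs => ?_
    rw [uIcc_of_le ht'.2] at hs
    simp only [hyz hs, hvw hs]
  rw [e1, e2] at hle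
  linarith

/-- The other half of the dynamic programming principle. -/
theorem integral_add_Qfun_le_cost (H : IsBoundedLipschitz f r q Cf Cr Cq Kf Kr Kq)
    (ht : 0 ≤ t) (ht' : t' ∈ Icc t T) (hu : Adm M T u) (hx : IsTrajectory f t T x u) :
    (∫ s in t..t', r (x s) (u s)) + Qfun f r q M T (x t') (u t') t' ≤ cost r q t T x u := by
  rw [H.cost_eq_add ht hu hx ht']
  exact add_le_add le_rfl (H.Qfun_le_cost ht'.2 hu (hx.mono_left ht'))

theorem Qfun_terminal (H : IsBoundedLipschitz f r q Cf Cr Cq Kf Kr Kq) (hM : 0 ≤ M)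
    (x₀ : EuclideanSpace ℝ (Fin n)) (u₀ : EuclideanSpace ℝ (Fin m)) :
    Qfun f r q M T x₀ u₀ T = q x₀ := by
  refine le_antisymm ?_ (le_of_forall_pos_le_add fun ε hε => ?_)
  · obtain ⟨x, u, hu, hx, hx0, hu0, -⟩ := H.exists_line (t := T) le_rfl hM x₀ u₀ 0 (by simpa)
    have := H.Qfun_le_cost le_rfl hu hx
    simpa [cost, hx0, hu0] using this
  · obtain ⟨x, u, hu, hx, hx0, hu0, h⟩ := H.exists_cost_lt (M := M) (le_refl T) hM x₀ u₀ hε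
    simpa [cost, hx0] using h.le

theorem Qfun_le_add_of_close (H : IsBoundedLipschitz f r q Cf Cr Cq Kf Kr Kq) (hM : 0 ≤ M)
    (ht : t ∈ Icc 0 T) (x₁ x₂ : EuclideanSpace ℝ (Fin n)) (u₁ u₂ : EuclideanSpace ℝ (Fin m))
    {δ : ℝ} (hxδ : ‖x₁ - x₂‖ ≤ δ) (huδ : ‖u₁ - u₂‖ ≤ δ) :
    Qfun f r q M T x₂ u₂ t ≤ Qfun f r q M T x₁ u₁ t +
      (Kr * T + Kq) * (2 * Real.exp ((Kf + 1) * T)) * δ := by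
  refine le_of_forall_pos_le_add fun ε hε => ?_
  have hδ : 0 ≤ δ := (norm_nonneg _).trans hxδ
  obtain ⟨x, u, hu, hx, hx0, hu0, hlt⟩ := H.exists_cost_lt (M := M) ht.2 hM x₁ u₁ hε
  have hsub : Icc t T ⊆ Icc 0 T := Icc_subset_Icc_left ht.1
  obtain ⟨v, hv_eq⟩ : ∃ v : ℝ → EuclideanSpace ℝ (Fin m), ∀ s, v s = u s + (u₂ - u₁) :=
    ⟨_, fun s => rfl⟩
  have hv : Adm M T v := by
    refine adm_of_norm_sub_le hM fun s hs s' hs' hss => ?_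
    have := hu.norm_sub_le hM hs' hs
    rw [abs_of_nonneg (sub_nonneg.2 hss)] at this
    rwa [hv_eq, hv_eq, add_sub_add_right_eq_sub]
  have hucont := hu.continuousOn.mono hsub
  have hvcont := hv.continuousOn.mono hsub
  obtain ⟨y, hy0, hy⟩ := exists_isTrajectory H.norm_f_le H.lipschitz_f ht.2 hvcont x₂
  have hvt : v t = u₂ := by rw [hv_eq, hu0]; abel
  have huv : ∀ s ∈ Icc t T, ‖u s - v s‖ ≤ δ := fun s _ => by
    rw [hv_eq, show u s - (u s + (u₂ - u₁)) = u₁ - u₂ by abel]; exact huδ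
  set C := 2 * Real.exp ((Kf + 1) * T)
  have hC1 : 1 ≤ C := by
    have : 1 ≤ Real.exp ((Kf + 1) * T) :=
      Real.one_le_exp (mul_nonneg (by positivity) (ht.1.trans ht.2))
    linarith
  have hclose : ∀ s ∈ Icc t T, ‖x s - y s‖ ≤ C * δ := fun s hs =>
    hx.norm_sub_le_of_close hy H.norm_f_le H.lipschitz_f ht.1 hucont hvcont
      (by rwa [hx0, hy0]) huv hs
  have hle := H.Qfun_le_cost ht.2 hv hy
  rw [hy0, hvt] at hle
  have htt : t ∈ Icc t T := ⟨le_rfl, ht.2⟩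
  have hTT : T ∈ Icc t T := ⟨ht.2, le_rfl⟩
  have hint : (∫ s in t..T, r (y s) (v s)) - ∫ s in t..T, r (x s) (u s) ≤ Kr * (C * δ) * T := by
    rw [← intervalIntegral.integral_sub (H.intervalIntegrable_r ht.1 hv hy htt hTT)
      (H.intervalIntegrable_r ht.1 hu hx htt hTT)]
    refine (Real.le_norm_self _).trans ((intervalIntegral.norm_integral_le_of_norm_le_const
      (C := Kr * (C * δ)) fun s hs => ?_).trans ?_)
    · rw [uIoc_of_le ht.2] at hs
      have hs' : s ∈ Icc t T := ⟨hs.1.le, hs.2⟩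
      refine (H.lipschitz_r.norm_sub_le_max _ _ _ _).trans ?_
      gcongr
      rw [norm_sub_rev, norm_sub_rev (v s)]
      exact max_le (hclose s hs') ((huv s hs').trans (le_mul_of_one_le_left hδ hC1))
    · rw [abs_of_nonneg (sub_nonneg.2 ht.2)]
      gcongr
      linarith [ht.1]
  have hq : q (y T) - q (x T) ≤ Kq * (C * δ) := by
    have := H.lipschitz_q.dist_le_mul (y T) (x T)
    rw [dist_eq_norm, dist_eq_norm, norm_sub_rev (y T)] at this
    refine (le_abs_self _).trans (this.trans ?_)
    gcongr
    exact hclose T hTT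
  rw [cost] at hle hlt
  linarith

theorem exists_lipschitz_Qfun (H : IsBoundedLipschitz f r q Cf Cr Cq Kf Kr Kq) (hM : 0 ≤ M)
    (hT : 0 ≤ T) :
    ∃ L, LipschitzOnWith L
      (fun p : EuclideanSpace ℝ (Fin n) × EuclideanSpace ℝ (Fin m) × ℝ =>
        Qfun f r q M T p.1 p.2.1 p.2.2) (univ ×ˢ univ ×ˢ Icc 0 T) := by
  set D : ℝ := (Kr * T + Kq) * (2 * Real.exp ((Kf + 1) * T))
  have hD0 : 0 ≤ D := by positivity
  have hCf := H.nonneg_Cf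
  have hCr := H.nonneg_Cr
  have htime : ∀ x₀ u₀ t t', 0 ≤ t → t ≤ t' → t' ≤ T →
      |Qfun f r q M T x₀ u₀ t - Qfun f r q M T x₀ u₀ t'| ≤
        (Cr + D * (Cf + M)) * (t' - t) := by
    intro x₀ u₀ t t' h0 h1 h2
    have ht' : t' ∈ Icc t T := ⟨h1, h2⟩
    have htt : t ∈ Icc t T := ⟨le_rfl, h1.trans h2⟩
    have hclose : ∀ x u, Adm M T u → IsTrajectory f t T x u → x t = x₀ → u t = u₀ →
        ‖x t' - x₀‖ ≤ (Cf + M) * (t' - t) ∧ ‖u t' - u₀‖ ≤ (Cf + M) * (t' - t) := by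
      rintro x u hu hx rfl rfl
      have a1 := hx.norm_sub_le H.norm_f_le htt ht'
      have a2 := hu.norm_sub_le hM (s := t') (s' := t) ⟨h0.trans h1, h2⟩ ⟨h0, h1.trans h2⟩
      rw [abs_of_nonneg (sub_nonneg.2 h1)] at a1 a2
      have h3 := sub_nonneg.2 h1
      constructor <;> nlinarith
    rw [abs_le]
    constructor
    · refine neg_le_of_neg_le (le_of_forall_pos_le_add fun ε hε => ?_)
      obtain ⟨x, u, hu, hx, hx0, hu0, hlt⟩ :=
        H.exists_cost_lt (M := M) (h1.trans h2) hM x₀ u₀ hε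
      obtain ⟨c1, c2⟩ := hclose x u hu hx hx0 hu0
      have b1 := H.integral_add_Qfun_le_cost h0 ht' hu hx
      have b2 := H.Qfun_le_add_of_close hM (t := t') ⟨h0.trans h1, h2⟩ _ _ _ _ c1 c2
      have b3 := abs_le.1 (H.abs_integral_r_le (x := x) (u := u) h1)
      linarith [b3.1]
    · obtain ⟨x, u, hu, hx, hx0, hu0, -⟩ := H.exists_line (h1.trans h2) hM x₀ u₀ 0 (by simpa)
      obtain ⟨c1, c2⟩ := hclose x u hu hx hx0 hu0
      have b1 := H.Qfun_le_integral_add hM h0 ht' hu hx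
      rw [norm_sub_rev] at c1 c2
      have b2 := H.Qfun_le_add_of_close hM (t := t') ⟨h0.trans h1, h2⟩ _ _ _ _ c1 c2
      have b3 := abs_le.1 (H.abs_integral_r_le (x := x) (u := u) h1)
      rw [hx0, hu0] at b1
      linarith [b3.2]
  have hE0 : 0 ≤ Cr + D * (Cf + M) := by positivity
  refine ⟨(D + (Cr + D * (Cf + M))).toNNReal, LipschitzOnWith.of_dist_le_mul ?_⟩
  rintro ⟨x₁, u₁, t₁⟩ ⟨-, -, h1⟩ ⟨x₂, u₂, t₂⟩ ⟨-, -, h2⟩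
  rw [Real.coe_toNNReal _ (add_nonneg hD0 hE0), Real.dist_eq]
  set d := dist (x₁, u₁, t₁) (x₂, u₂, t₂)
  have d1 : ‖x₁ - x₂‖ ≤ d := by rw [← dist_eq_norm]; exact le_max_left _ _
  have d2 : ‖u₁ - u₂‖ ≤ d := by
    rw [← dist_eq_norm]; exact (le_max_left _ _).trans (le_max_right _ _)
  have d3 : |t₁ - t₂| ≤ d := by
    rw [← Real.dist_eq]; exact (le_max_right _ _).trans (le_max_right _ _)
  have s1 := H.Qfun_le_add_of_close hM h1 _ _ _ _ d1 d2
  have s2 := H.Qfun_le_add_of_close hM h1 _ _ _ _ (norm_sub_rev x₁ x₂ ▸ d1)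
    (norm_sub_rev u₁ u₂ ▸ d2)
  have htime' : |Qfun f r q M T x₂ u₂ t₁ - Qfun f r q M T x₂ u₂ t₂| ≤
      (Cr + D * (Cf + M)) * d := by
    refine le_trans ?_ (mul_le_mul_of_nonneg_left d3 hE0)
    rcases le_total t₁ t₂ with h | h
    · rw [abs_sub_comm t₁, abs_of_nonneg (sub_nonneg.2 h)]
      exact htime _ _ _ _ h1.1 h h2.2
    · rw [abs_of_nonneg (sub_nonneg.2 h), abs_sub_comm]
      exact htime _ _ _ _ h2.1 h h1.2
  have hsum := abs_sub_le (Qfun f r q M T x₁ u₁ t₁) (Qfun f r q M T x₂ u₂ t₁)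
    (Qfun f r q M T x₂ u₂ t₂)
  have hspace : |Qfun f r q M T x₁ u₁ t₁ - Qfun f r q M T x₂ u₂ t₁| ≤ D * d :=
    abs_le.2 ⟨by linarith, by linarith⟩
  change |Qfun f r q M T x₁ u₁ t₁ - Qfun f r q M T x₂ u₂ t₂| ≤ _
  linarith

/-- In a short time no admissible pair started at a point leaves a given neighbourhood. -/
theorem eventually_forall_trajectory (H : IsBoundedLipschitz f r q Cf Cr Cq Kf Kr Kq)
    (hM : 0 ≤ M) (ht : t ∈ Ioo 0 T) {x₀ : EuclideanSpace ℝ (Fin n)}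
    {u₀ : EuclideanSpace ℝ (Fin m)}
    {P : EuclideanSpace ℝ (Fin n) × EuclideanSpace ℝ (Fin m) × ℝ → Prop}
    (hP : ∀ᶠ p in 𝓝 (x₀, u₀, t), P p) :
    ∀ᶠ h in 𝓝[>] (0 : ℝ), t + h ∈ Ioo t T ∧
      ∀ x u, Adm M T u → IsTrajectory f t T x u → x t = x₀ → u t = u₀ →
        ‖(x (t + h), u (t + h), t + h) - (x₀, u₀, t)‖ ≤ (Cf + M + 1) * h ∧
        P (x (t + h), u (t + h), t + h) := by
  obtain ⟨δ, hδ, hball⟩ := Metric.eventually_nhds_iff.1 hP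
  have hCf := H.nonneg_Cf
  have hC : 0 < Cf + M + 1 := by positivity
  filter_upwards [Ioo_mem_nhdsGT (show (0 : ℝ) < min (T - t) (δ / (Cf + M + 1)) from
    lt_min (sub_pos.2 ht.2) (div_pos hδ hC))] with h hh
  have h0 : 0 < h := hh.1
  have hT : h < T - t := hh.2.trans_le (min_le_left _ _)
  have hhδ : h < δ / (Cf + M + 1) := hh.2.trans_le (min_le_right _ _)
  refine ⟨⟨by linarith, by linarith⟩, ?_⟩
  rintro x u hu hx rfl rfl
  have a1 := hx.norm_sub_le H.norm_f_le (s := t) (s' := t + h) ⟨le_rfl, ht.2.le⟩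
    ⟨by linarith, by linarith⟩
  have a2 := hu.norm_sub_le hM (s := t + h) (s' := t) ⟨by linarith [ht.1], by linarith⟩
    ⟨ht.1.le, ht.2.le⟩
  rw [add_sub_cancel_left, abs_of_pos h0] at a1 a2
  have key : ‖(x (t + h), u (t + h), t + h) - (x t, u t, t)‖ ≤ (Cf + M + 1) * h := by
    refine max_le ?_ (max_le ?_ ?_)
    · change ‖x (t + h) - x t‖ ≤ _
      nlinarith
    · change ‖u (t + h) - u t‖ ≤ _
      nlinarith
    · change ‖t + h - t‖ ≤ _
      rw [add_sub_cancel_left, Real.norm_of_nonneg h0.le]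
      nlinarith [mul_nonneg hCf h0.le, mul_nonneg hM h0.le]
  refine ⟨key, hball ?_⟩
  rw [dist_eq_norm]
  refine key.trans_lt ?_
  rwa [lt_div_iff₀ hC, mul_comm] at hhδ

/-- First order expansion of a test function plus running cost, uniform in the control. -/
theorem eventually_abs_expansion_le (H : IsBoundedLipschitz f r q Cf Cr Cq Kf Kr Kq)
    (hM : 0 ≤ M) (ht : t ∈ Ioo 0 T) {x₀ : EuclideanSpace ℝ (Fin n)}
    {u₀ : EuclideanSpace ℝ (Fin m)}
    {R : EuclideanSpace ℝ (Fin n) × EuclideanSpace ℝ (Fin m) × ℝ → ℝ}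
    {L : EuclideanSpace ℝ (Fin n) × EuclideanSpace ℝ (Fin m) × ℝ →L[ℝ] ℝ}
    (hR : HasFDerivAt R L (x₀, u₀, t)) {ε : ℝ} (hε : 0 < ε) :
    ∀ᶠ h in 𝓝[>] (0 : ℝ),
      ∀ x u, Adm M T u → IsTrajectory f t T x u → x t = x₀ → u t = u₀ →
        |R (x (t + h), u (t + h), t + h) - R (x₀, u₀, t) +
          (∫ s in t..t + h, r (x s) (u s)) -
          (h * (L (f x₀ u₀, 0, 1) + r x₀ u₀) + L (0, u (t + h) - u₀, 0))| ≤ ε * h := by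
  have hCf := H.nonneg_Cf
  have hC : 0 < Cf + M + 1 := by positivity
  have hη : 0 < ε / 2 / (Cf + M + 1) := by positivity
  set B : ℝ := ‖L‖ * (Kf * (Cf + M)) + Kr * (Cf + M) with hB
  have hB0 : 0 ≤ B := by positivity
  have hsmall : ∀ᶠ h in 𝓝[>] (0 : ℝ), B * h < ε / 2 := by
    have : Tendsto (fun h : ℝ => B * h) (𝓝[>] 0) (𝓝 (B * 0)) :=
      ((continuous_const.mul continuous_id).tendsto 0).mono_left nhdsWithin_le_nhds
    rw [mul_zero] at this
    exact this.eventually_lt_const (by positivity)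
  filter_upwards [H.eventually_forall_trajectory (M := M) hM ht (hR.isLittleO.def hη), hsmall,
    self_mem_nhdsWithin] with h ⟨hhT, hh⟩ hBh h0
  replace h0 : 0 < h := h0
  intro x u hu hx hx0 hu0
  obtain ⟨c1, c2⟩ := hh x u hu hx hx0 hu0
  have c3 : ‖R (x (t + h), u (t + h), t + h) - R (x₀, u₀, t) -
      L ((x (t + h), u (t + h), t + h) - (x₀, u₀, t))‖ ≤ ε / 2 * h := by
    refine c2.trans ((mul_le_mul_of_nonneg_left c1 hη.le).trans_eq ?_)
    field_simp
  have htt : t ∈ Icc t T := ⟨le_rfl, ht.2.le⟩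
  have hth : t + h ∈ Icc t T := ⟨hhT.1.le, hhT.2.le⟩
  have e1 := hx.norm_integral_sub_le hu hM ht.1.le H.norm_f_le H.lipschitz_f hth
  have e2 := hx.norm_integral_sub_le hu hM ht.1.le H.norm_f_le H.lipschitz_r hth
  rw [← hx.sub_eq_integral htt hth] at e1
  rw [add_sub_cancel_left, hx0, hu0] at e1 e2
  have hsplit : L ((x (t + h), u (t + h), t + h) - (x₀, u₀, t)) =
      L (x (t + h) - x₀ - h • f x₀ u₀, 0, 0) + h * L (f x₀ u₀, 0, 1) +
        L (0, u (t + h) - u₀, 0) := by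
    rw [← smul_eq_mul, ← map_smul, ← map_add, ← map_add]
    congr 1
    simp
  have e3 : |L (x (t + h) - x₀ - h • f x₀ u₀, 0, 0)| ≤ ‖L‖ * (Kf * (Cf + M) * h * h) := by
    refine (L.le_opNorm _).trans ?_
    gcongr
    refine (max_le le_rfl (max_le ?_ ?_)).trans e1 <;> simp
  rw [hsplit] at c3
  rw [Real.norm_eq_abs] at c3 e2
  rw [smul_eq_mul] at e2
  have e4 : B * h * h ≤ ε / 2 * h := by gcongr
  rw [abs_le] at *
  constructor <;> nlinarith

end IsBoundedLipschitz

section TestFunction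

variable {n m : ℕ}
  {f : EuclideanSpace ℝ (Fin n) → EuclideanSpace ℝ (Fin m) → EuclideanSpace ℝ (Fin n)}
  {r : EuclideanSpace ℝ (Fin n) → EuclideanSpace ℝ (Fin m) → ℝ} {M t : ℝ}
  {x₀ : EuclideanSpace ℝ (Fin n)} {u₀ : EuclideanSpace ℝ (Fin m)}
  {R : EuclideanSpace ℝ (Fin n) × EuclideanSpace ℝ (Fin m) × ℝ → ℝ}
  {L : EuclideanSpace ℝ (Fin n) × EuclideanSpace ℝ (Fin m) × ℝ →L[ℝ] ℝ}

theorem inner_gradient_control (hR : HasFDerivAt R L (x₀, u₀, t))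
    (w : EuclideanSpace ℝ (Fin m)) :
    ⟪gradient (fun u => R (x₀, u, t)) u₀, w⟫ = L (0, w, 0) := by
  have h := HasFDerivAt.comp (f := fun u => (x₀, u, t)) u₀ hR
    ((hasFDerivAt_prodMk_right (𝕜 := ℝ) x₀ (u₀, t)).comp (f := fun u => (u, t)) u₀
      (hasFDerivAt_prodMk_left u₀ t))
  change ⟪gradient (R ∘ fun u => (x₀, u, t)) u₀, w⟫ = _
  rw [gradient, h.fderiv, InnerProductSpace.toDual_symm_apply]
  simp

theorem inner_gradient_state (hR : HasFDerivAt R L (x₀, u₀, t))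
    (w : EuclideanSpace ℝ (Fin n)) :
    ⟪gradient (fun x => R (x, u₀, t)) x₀, w⟫ = L (w, 0, 0) := by
  have h := HasFDerivAt.comp (f := fun x => (x, u₀, t)) x₀ hR
    (hasFDerivAt_prodMk_left x₀ (u₀, t))
  change ⟪gradient (R ∘ fun x => (x, u₀, t)) x₀, w⟫ = _
  rw [gradient, h.fderiv, InnerProductSpace.toDual_symm_apply]
  rfl

theorem deriv_time (hR : HasFDerivAt R L (x₀, u₀, t)) :
    deriv (fun s => R (x₀, u₀, s)) t = L (0, 0, 1) := by
  have h : HasDerivAt (fun s : ℝ => (x₀, u₀, s)) (0, 0, 1) t :=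
    (hasDerivAt_const t x₀).prodMk ((hasDerivAt_const t u₀).prodMk (hasDerivAt_id t))
  exact (hR.comp_hasDerivAt t h).deriv

theorem hjbExpr_eq (hR : HasFDerivAt R L (x₀, u₀, t)) :
    hjbExpr f r M R x₀ u₀ t =
      L (f x₀ u₀, 0, 1) + r x₀ u₀ - M * ‖gradient (fun u => R (x₀, u, t)) u₀‖ := by
  have : L (f x₀ u₀, 0, 1) = L (0, 0, 1) + L (f x₀ u₀, 0, 0) := by
    rw [← map_add]; simp
  rw [hjbExpr, deriv_time hR, inner_gradient_state hR, this]
  ring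

theorem ContDiffOn.hasFDerivAt_of_mem_Ioo {T : ℝ}
    (hR : ContDiffOn ℝ 1 R (univ ×ˢ univ ×ˢ Ioo 0 T)) (ht : t ∈ Ioo 0 T) :
    HasFDerivAt R (fderiv ℝ R (x₀, u₀, t)) (x₀, u₀, t) :=
  ((hR.differentiableOn one_ne_zero).differentiableAt
    ((isOpen_univ.prod (isOpen_univ.prod isOpen_Ioo)).mem_nhds
      ⟨mem_univ _, mem_univ _, ht⟩)).hasFDerivAt

end TestFunction

namespace IsBoundedLipschitz

variable {n m : ℕ}
  {f : EuclideanSpace ℝ (Fin n) → EuclideanSpace ℝ (Fin m) → EuclideanSpace ℝ (Fin n)}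
  {r : EuclideanSpace ℝ (Fin n) → EuclideanSpace ℝ (Fin m) → ℝ}
  {q : EuclideanSpace ℝ (Fin n) → ℝ} {M T t : ℝ} {Cf Cr Cq : ℝ} {Kf Kr Kq : NNReal}
  {x₀ : EuclideanSpace ℝ (Fin n)} {u₀ : EuclideanSpace ℝ (Fin m)}
  {R : EuclideanSpace ℝ (Fin n) × EuclideanSpace ℝ (Fin m) × ℝ → ℝ}
  {L : EuclideanSpace ℝ (Fin n) × EuclideanSpace ℝ (Fin m) × ℝ →L[ℝ] ℝ}

theorem hjbExpr_nonneg (H : IsBoundedLipschitz f r q Cf Cr Cq Kf Kr Kq) (hM : 0 ≤ M)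
    (ht : t ∈ Ioo 0 T) (hR : HasFDerivAt R L (x₀, u₀, t))
    (hmax : IsLocalMax (fun p => Qfun f r q M T p.1 p.2.1 p.2.2 - R p) (x₀, u₀, t)) :
    0 ≤ hjbExpr f r M R x₀ u₀ t := by
  rw [hjbExpr_eq hR]
  set g := gradient (fun u => R (x₀, u, t)) u₀ with hg
  refine le_of_forall_pos_le_add fun ε hε => ?_
  obtain ⟨h, ⟨hhT, hloc⟩, hexp, h0⟩ :=
    ((H.eventually_forall_trajectory (M := M) hM ht hmax).and
      ((H.eventually_abs_expansion_le (M := M) hM ht hR hε).and self_mem_nhdsWithin)).exists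
  replace h0 : 0 < h := h0
  have hw : ‖(-(M / ‖g‖)) • g‖ ≤ M := by
    rw [norm_smul, norm_neg, Real.norm_of_nonneg (by positivity)]
    rcases eq_or_ne ‖g‖ 0 with h | h
    · simpa [h] using hM
    · rw [div_mul_cancel₀ _ h]
  have hgw : ⟪g, (-(M / ‖g‖)) • g⟫ = -(M * ‖g‖) := by
    rw [real_inner_smul_right, real_inner_self_eq_norm_sq]
    rcases eq_or_ne ‖g‖ 0 with h | h
    · simp [h]
    · field_simp
  obtain ⟨x, u, hu, hx, hx0, hu0, hline⟩ := H.exists_line (M := M) ht.2.le hM x₀ u₀ _ hw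
  have a1 := (hloc x u hu hx hx0 hu0).2
  have a2 := (abs_le.1 (hexp x u hu hx hx0 hu0)).2
  have a3 := H.Qfun_le_integral_add hM ht.1.le ⟨hhT.1.le, hhT.2.le⟩ hu hx
  have a4 : L (0, u (t + h) - u₀, 0) = h * -(M * ‖g‖) := by
    rw [← inner_gradient_control hR, ← hg, hline, add_sub_cancel_left, add_sub_cancel_left,
      real_inner_smul_right, hgw]
  rw [hx0, hu0] at a3
  rw [a4] at a2
  dsimp only at a1
  refine le_of_mul_le_mul_left ?_ h0
  linarith

theorem hjbExpr_nonpos (H : IsBoundedLipschitz f r q Cf Cr Cq Kf Kr Kq) (hM : 0 ≤ M)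
    (ht : t ∈ Ioo 0 T) (hR : HasFDerivAt R L (x₀, u₀, t))
    (hmin : IsLocalMin (fun p => Qfun f r q M T p.1 p.2.1 p.2.2 - R p) (x₀, u₀, t)) :
    hjbExpr f r M R x₀ u₀ t ≤ 0 := by
  rw [hjbExpr_eq hR]
  set g := gradient (fun u => R (x₀, u, t)) u₀ with hg
  refine le_of_forall_pos_le_add fun ε hε => ?_
  obtain ⟨h, ⟨hhT, hloc⟩, hexp, h0⟩ :=
    ((H.eventually_forall_trajectory (M := M) hM ht hmin).and
      ((H.eventually_abs_expansion_le (M := M) hM ht hR (half_pos hε)).and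
        self_mem_nhdsWithin)).exists
  replace h0 : 0 < h := h0
  obtain ⟨x, u, hu, hx, hx0, hu0, hlt⟩ :=
    H.exists_cost_lt (M := M) ht.2.le hM x₀ u₀ (mul_pos (half_pos hε) h0)
  have a1 := (hloc x u hu hx hx0 hu0).2
  have a2 := (abs_le.1 (hexp x u hu hx hx0 hu0)).1
  have a3 := H.integral_add_Qfun_le_cost ht.1.le ⟨hhT.1.le, hhT.2.le⟩ hu hx
  have a4 : -(‖g‖ * (M * h)) ≤ L (0, u (t + h) - u₀, 0) := by
    rw [← inner_gradient_control hR, ← hg]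
    have hub := hu.norm_sub_le hM (s := t + h) (s' := t)
      ⟨ht.1.le.trans hhT.1.le, hhT.2.le⟩ ⟨ht.1.le, ht.2.le⟩
    rw [hu0, add_sub_cancel_left, abs_of_pos h0] at hub
    exact neg_le_of_abs_le ((abs_real_inner_le_norm _ _).trans
      (mul_le_mul_of_nonneg_left hub (norm_nonneg _)))
  dsimp only at a1
  refine le_of_mul_le_mul_left ?_ h0
  linarith

end IsBoundedLipschitz

/-- **Theorem 1 (existence part)**: under (A1) and (A2), the Q-function is a viscosity
solution of the HJB equation `∂_t Q + ∇ₓQ · f − M|∇ᵤQ| + r = 0` with terminal condition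
`Q(x, u, T) = q(x)`. -/
theorem Qfun_isViscositySolution {n m : ℕ}
    (f : EuclideanSpace ℝ (Fin n) → EuclideanSpace ℝ (Fin m) → EuclideanSpace ℝ (Fin n))
    (r : EuclideanSpace ℝ (Fin n) → EuclideanSpace ℝ (Fin m) → ℝ)
    (q : EuclideanSpace ℝ (Fin n) → ℝ) (M T : ℝ) (hM : 0 < M) (hT : 0 < T)
    (Cf Cr Cq : ℝ)
    (hfb : ∀ x u, ‖f x u‖ ≤ Cf) (hrb : ∀ x u, |r x u| ≤ Cr) (hqb : ∀ x, |q x| ≤ Cq)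
    (Kf Kr Kq : NNReal)
    (hfl : LipschitzWith Kf (fun p : EuclideanSpace ℝ (Fin n) × EuclideanSpace ℝ (Fin m) => f p.1 p.2))
    (hrl : LipschitzWith Kr (fun p : EuclideanSpace ℝ (Fin n) × EuclideanSpace ℝ (Fin m) => r p.1 p.2))
    (hql : LipschitzWith Kq q) :
    IsViscositySolution f r q M T
      (fun p : EuclideanSpace ℝ (Fin n) × EuclideanSpace ℝ (Fin m) × ℝ =>
        Qfun f r q M T p.1 p.2.1 p.2.2) := by
  have H : IsBoundedLipschitz f r q Cf Cr Cq Kf Kr Kq := ⟨hfb, hrb, hqb, hfl, hrl, hql⟩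
  obtain ⟨L, hL⟩ := H.exists_lipschitz_Qfun hM.le hT.le
  have hnhds : ∀ (x₀ : EuclideanSpace ℝ (Fin n)) (u₀ : EuclideanSpace ℝ (Fin m)),
      ∀ t₀ ∈ Ioo 0 T, (univ ×ˢ univ ×ˢ Ioo 0 T : Set (EuclideanSpace ℝ (Fin n) ×
        EuclideanSpace ℝ (Fin m) × ℝ)) ∈ 𝓝 (x₀, u₀, t₀) := fun x₀ u₀ t₀ ht₀ =>
    (isOpen_univ.prod (isOpen_univ.prod isOpen_Ioo)).mem_nhds ⟨mem_univ _, mem_univ _, ht₀⟩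
  refine ⟨hL.continuousOn, H.Qfun_terminal hM.le, ?_, ?_⟩
  · intro R hR x₀ u₀ t₀ ht₀ hmax
    exact H.hjbExpr_nonneg hM.le ht₀ (hR.hasFDerivAt_of_mem_Ioo ht₀)
      (hmax.isLocalMax (hnhds x₀ u₀ t₀ ht₀))
  · intro R hR x₀ u₀ t₀ ht₀ hmin
    exact H.hjbExpr_nonpos hM.le ht₀ (hR.hasFDerivAt_of_mem_Ioo ht₀)
      (hmin.isLocalMin (hnhds x₀ u₀ t₀ ht₀))

end
end

section
/- Under assumptions (A1) and (A2), the viscosity solution of the HJB equation ∂_t Q + ∇_x Q · f(x, u) − M|∇_u Q| + r(x, u) = 0 with terminal condition Q(x, u, T) = q(x) is unique: if Q₁ and Q₂ are both continuous functions on ℝ^n × ℝ^m × [0,T] satisfying the viscosity solution conditions (terminal condition, subsolution property via local maxima of Q − R for C¹ test functions R, and supersolution property via local minima), then Q₁ = Q₂. -/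
open MeasureTheory Set RealInnerProductSpace

noncomputable section

/-- Doubling of variables: the maximizers of `a p - b q - k * φ (p, q)` over `K × K` accumulate,
as `k → ∞`, at a maximizer of `a - b` over `K`. -/
theorem exists_doubled_max_near {X : Type*} [MetricSpace X] {K : Set X} (hK : IsCompact K)
    (hne : K.Nonempty) {a b : X → ℝ} (ha : ContinuousOn a K) (hb : ContinuousOn b K)
    {φ : X × X → ℝ} (hφ : Continuous φ) (hφ0 : ∀ p, 0 ≤ φ p) (hφd : ∀ p, φ (p, p) = 0)
    (hφe : ∀ p q, φ (p, q) = 0 → p = q) :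
    ∃ z ∈ K, (∀ p ∈ K, a p - b p ≤ a z - b z) ∧ ∀ U ∈ nhds z, ∀ δ > 0,
      ∃ k : ℝ, 0 ≤ k ∧ ∃ p ∈ U, ∃ q ∈ U, k * φ (p, q) < δ ∧
        ∀ p' ∈ K, ∀ q' ∈ K, a p' - b q' - k * φ (p', q') ≤ a p - b q - k * φ (p, q) := by
  have hab : ContinuousOn (fun w : X × X => a w.1 - b w.2) (K ×ˢ K) :=
    (ha.comp continuousOn_fst fun _ h => h.1).sub (hb.comp continuousOn_snd fun _ h => h.2)
  have hmax (k : ℕ) : ∃ w ∈ K ×ˢ K, ∀ w' ∈ K ×ˢ K,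
      a w'.1 - b w'.2 - k * φ w' ≤ a w.1 - b w.2 - k * φ w :=
    (hK.prod hK).exists_isMaxOn (hne.prod hne)
      (hab.sub (continuousOn_const.mul hφ.continuousOn))
  choose w hwK hw using hmax
  obtain ⟨⟨z, z'⟩, hzK, ψ, hψ, hlim⟩ := (hK.prod hK).tendsto_subseq hwK
  obtain ⟨z₀, hz₀, hz₀max⟩ := hK.exists_isMaxOn hne (ha.sub hb)
  have hψt : Filter.Tendsto (fun j => (ψ j : ℝ)) Filter.atTop Filter.atTop :=
    tendsto_natCast_atTop_atTop.comp hψ.tendsto_atTop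
  have hlimK : Filter.Tendsto (w ∘ ψ) Filter.atTop (nhdsWithin (z, z') (K ×ˢ K)) :=
    tendsto_nhdsWithin_iff.2 ⟨hlim, Filter.Eventually.of_forall fun j => hwK _⟩
  have hval : Filter.Tendsto (fun j => a (w (ψ j)).1 - b (w (ψ j)).2 - (a z₀ - b z₀))
      Filter.atTop (nhds (a z - b z' - (a z₀ - b z₀))) :=
    ((hab (z, z') hzK).tendsto.comp hlimK).sub_const _
  have hle (j : ℕ) : (ψ j : ℝ) * φ (w (ψ j)) ≤
      a (w (ψ j)).1 - b (w (ψ j)).2 - (a z₀ - b z₀) := by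
    have := hw (ψ j) (z₀, z₀) ⟨hz₀, hz₀⟩
    simp only [hφd, mul_zero, sub_zero] at this
    linarith
  have hφlim : Filter.Tendsto (fun j => φ (w (ψ j))) Filter.atTop (nhds (φ (z, z'))) :=
    (hφ.tendsto _).comp hlim
  have hφz : φ (z, z') = 0 := by
    by_contra hne0
    have hpos : 0 < φ (z, z') := lt_of_le_of_ne (hφ0 _) (Ne.symm hne0)
    exact not_tendsto_nhds_of_tendsto_atTop
      (Filter.tendsto_atTop_mono hle (hψt.atTop_mul_pos hpos hφlim)) _ hval
  obtain rfl := hφe _ _ hφz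
  have hz₀z : a z - b z - (a z₀ - b z₀) ≤ 0 := sub_nonpos.2 (hz₀max hzK.1)
  refine ⟨z, hzK.1, fun p hp => ?_, fun U hU δ hδ => ?_⟩
  · have h1 : a p - b p ≤ a z₀ - b z₀ := hz₀max hp
    have h2 : 0 ≤ a z - b z - (a z₀ - b z₀) :=
      ge_of_tendsto hval (Filter.Eventually.of_forall fun j =>
        (mul_nonneg (Nat.cast_nonneg _) (hφ0 _)).trans (hle j))
    linarith
  · obtain ⟨j, hj, hjU⟩ := ((hval.eventually_lt_const (hz₀z.trans_lt hδ)).and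
      (hlim.eventually (prod_mem_nhds hU hU))).exists
    exact ⟨ψ j, Nat.cast_nonneg _, (w (ψ j)).1, hjU.1, (w (ψ j)).2, hjU.2, (hle j).trans_lt hj,
      fun p' hp' q' hq' => hw (ψ j) (p', q') ⟨hp', hq'⟩⟩

section Gradient

variable {F : Type*} [NormedAddCommGroup F] [InnerProductSpace ℝ F] [CompleteSpace F]

theorem hasGradientAt_comp_norm_sub_sq {h : ℝ → ℝ} {c : ℝ} {a x : F}
    (hh : HasDerivAt h c (‖x - a‖ ^ 2)) :
    HasGradientAt (fun y => h (‖y - a‖ ^ 2)) ((2 * c) • (x - a)) x := by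
  rw [hasGradientAt_iff_hasFDerivAt]
  have h1 : HasFDerivAt (fun y : F => ‖y - a‖ ^ 2) (2 • (innerSL ℝ (x - a))) x := by
    simpa using ((hasFDerivAt_id x).sub_const a).norm_sq
  refine (hh.comp_hasFDerivAt x h1).congr_fderiv ?_
  ext v
  simp
  ring

theorem hasGradientAt_add {h₁ h₂ : F → ℝ} {v₁ v₂ x : F} (h1 : HasGradientAt h₁ v₁ x)
    (h2 : HasGradientAt h₂ v₂ x) : HasGradientAt (fun y => h₁ y + h₂ y) (v₁ + v₂) x := by
  rw [hasGradientAt_iff_hasFDerivAt] at h1 h2 ⊢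
  rw [map_add]
  exact h1.add h2

/-- A smooth penalty which decreases in time faster than it varies in space. -/
def conePenalty {E F : Type*} [NormedAddCommGroup E] [NormedAddCommGroup F]
    (N L c : ℝ) (x₀ : E) (u₀ : F) (p : E × F × ℝ) : ℝ :=
  Real.exp (N * (√(1 + ‖p.1 - x₀‖ ^ 2 + ‖p.2.1 - u₀‖ ^ 2) - L * p.2.2 - c))

/-- The squared Euclidean distance on the product. -/
def sqDist {E F : Type*} [NormedAddCommGroup E] [NormedAddCommGroup F]
    (p q : E × F × ℝ) : ℝ :=
  ‖p.1 - q.1‖ ^ 2 + ‖p.2.1 - q.2.1‖ ^ 2 + (p.2.2 - q.2.2) ^ 2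

theorem sqDist_comm {E F : Type*} [NormedAddCommGroup E] [NormedAddCommGroup F]
    (p q : E × F × ℝ) : sqDist p q = sqDist q p := by
  simp only [sqDist, norm_sub_rev p.1, norm_sub_rev p.2.1, ← neg_sub p.2.2 q.2.2, neg_sq]

variable {E : Type*} [NormedAddCommGroup E] [InnerProductSpace ℝ E]

omit [CompleteSpace F] in
theorem contDiff_conePenalty (N L c : ℝ) (x₀ : E) (u₀ : F) :
    ContDiff ℝ 1 (conePenalty N L c x₀ u₀) := by
  have h1 : ContDiff ℝ 1 fun p : E × F × ℝ => ‖p.1 - x₀‖ ^ 2 :=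
    (contDiff_fst.sub contDiff_const).norm_sq ℝ
  have h2 : ContDiff ℝ 1 fun p : E × F × ℝ => ‖p.2.1 - u₀‖ ^ 2 :=
    (contDiff_snd.fst.sub contDiff_const).norm_sq ℝ
  have h3 : ContDiff ℝ 1 fun p : E × F × ℝ => √(1 + ‖p.1 - x₀‖ ^ 2 + ‖p.2.1 - u₀‖ ^ 2) :=
    ((contDiff_const.add h1).add h2).sqrt fun p => by positivity
  exact (contDiff_const.mul ((h3.sub (contDiff_const.mul contDiff_snd.snd)).sub
    contDiff_const)).exp

omit [CompleteSpace F] in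
theorem contDiff_sqDist_left (q : E × F × ℝ) : ContDiff ℝ 1 fun p => sqDist p q :=
  (((contDiff_fst.sub contDiff_const).norm_sq ℝ).add
    ((contDiff_snd.fst.sub contDiff_const).norm_sq ℝ)).add
    ((contDiff_snd.snd.sub contDiff_const).pow 2)

end Gradient

section Derivatives

variable {n m : ℕ}
  (f : EuclideanSpace ℝ (Fin n) → EuclideanSpace ℝ (Fin m) → EuclideanSpace ℝ (Fin n))
  (r : EuclideanSpace ℝ (Fin n) → EuclideanSpace ℝ (Fin m) → ℝ)

theorem hjbExpr_neg_sqDist (M k : ℝ) (p : EuclideanSpace ℝ (Fin n) × EuclideanSpace ℝ (Fin m) × ℝ)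
    (y : EuclideanSpace ℝ (Fin n)) (v : EuclideanSpace ℝ (Fin m)) (s : ℝ) :
    hjbExpr f r M (fun q => -(k * sqDist p q)) y v s =
      2 * k * (p.2.2 - s) + ⟪(2 * k) • (p.1 - y), f y v⟫ -
        M * ‖(2 * k) • (p.2.1 - v)‖ + r y v := by
  have ht : HasDerivAt (fun s => -(k * sqDist (y, v, s) p)) (2 * k * (p.2.2 - s)) s := by
    have := ((((hasDerivAt_id s).sub_const p.2.2).pow 2).const_add
      (‖y - p.1‖ ^ 2 + ‖v - p.2.1‖ ^ 2)).const_mul (-k)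
    refine (this.congr_deriv ?_).congr_of_eventuallyEq (Filter.Eventually.of_forall fun s => ?_)
    · simp; ring
    · simp [sqDist]
  have hx : HasGradientAt (fun y => -(k * sqDist (y, v, s) p)) ((2 * k) • (p.1 - y)) y := by
    have := hasGradientAt_comp_norm_sub_sq (h := fun z => -k * (z + ‖v - p.2.1‖ ^ 2 +
      (s - p.2.2) ^ 2)) (c := -k) (a := p.1) (x := y) (by
        have := ((((hasDerivAt_id (‖y - p.1‖ ^ 2)).add_const (‖v - p.2.1‖ ^ 2)).add_const
          ((s - p.2.2) ^ 2)).const_mul (-k))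
        simpa using this)
    convert this using 1
    · simp [sqDist]
    · rw [← neg_sub y, smul_neg, ← neg_smul]; ring_nf
  have hu : HasGradientAt (fun v => -(k * sqDist (y, v, s) p)) ((2 * k) • (p.2.1 - v)) v := by
    have := hasGradientAt_comp_norm_sub_sq (h := fun z => -k * (‖y - p.1‖ ^ 2 + z +
      (s - p.2.2) ^ 2)) (c := -k) (a := p.2.1) (x := v) (by
        have := ((((hasDerivAt_id (‖v - p.2.1‖ ^ 2)).const_add (‖y - p.1‖ ^ 2)).add_const
          ((s - p.2.2) ^ 2)).const_mul (-k))
        simpa using this)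
    convert this using 1
    · simp [sqDist]
    · rw [← neg_sub v, smul_neg, ← neg_smul]; ring_nf
  simp only [sqDist_comm p]
  rw [hjbExpr, ht.deriv, hx.gradient, hu.gradient]

theorem hjbExpr_conePenalty_add_sqDist_le {M Cf : ℝ} (hM : 0 ≤ M) (hfb : ∀ x u, ‖f x u‖ ≤ Cf)
    {N : ℝ} (hN : 0 ≤ N) (c k : ℝ) (x₀ : EuclideanSpace ℝ (Fin n)) (u₀ : EuclideanSpace ℝ (Fin m))
    (q : EuclideanSpace ℝ (Fin n) × EuclideanSpace ℝ (Fin m) × ℝ)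
    (x : EuclideanSpace ℝ (Fin n)) (u : EuclideanSpace ℝ (Fin m)) (t : ℝ) :
    hjbExpr f r M (fun p => conePenalty N (Cf + M + 1) c x₀ u₀ p + k * sqDist p q) x u t ≤
      2 * k * (t - q.2.2) + ⟪(2 * k) • (x - q.1), f x u⟫ -
        M * ‖(2 * k) • (u - q.2.1)‖ + r x u - N * conePenalty N (Cf + M + 1) c x₀ u₀ (x, u, t) := by
  set L := Cf + M + 1 with hL
  set g := conePenalty N L c x₀ u₀ (x, u, t) with hg
  set ρ := √(1 + ‖x - x₀‖ ^ 2 + ‖u - u₀‖ ^ 2) with hρ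
  have hpos : 0 < 1 + ‖x - x₀‖ ^ 2 + ‖u - u₀‖ ^ 2 := by positivity
  have hρ0 : 0 < ρ := Real.sqrt_pos.2 hpos
  have hg0 : 0 < g := Real.exp_pos _
  have ht : HasDerivAt (fun s => conePenalty N L c x₀ u₀ (x, u, s) + k * sqDist (x, u, s) q)
      (-(L * (N * g)) + 2 * k * (t - q.2.2)) t := by
    have h1 := (((((hasDerivAt_id t).const_mul L).const_sub ρ).sub_const c).const_mul N).exp
    have h2 := ((((hasDerivAt_id t).sub_const q.2.2).pow 2).const_add
      (‖x - q.1‖ ^ 2 + ‖u - q.2.1‖ ^ 2)).const_mul k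
    refine ((h1.add h2).congr_deriv ?_).congr_of_eventuallyEq
      (Filter.Eventually.of_forall fun s => ?_)
    · simp [hg, conePenalty, hρ]; ring
    · simp [sqDist, conePenalty, hρ]
  have hx : HasGradientAt
      (fun x => conePenalty N L c x₀ u₀ (x, u, t) + k * sqDist (x, u, t) q)
      ((N * g / ρ) • (x - x₀) + (2 * k) • (x - q.1)) x := by
    have h1 := hasGradientAt_comp_norm_sub_sq (a := x₀) (x := x)
      (((((((hasDerivAt_id (‖x - x₀‖ ^ 2)).const_add 1).add_const (‖u - u₀‖ ^ 2)).sqrt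
        hpos.ne').sub_const (L * t)).sub_const c).const_mul N).exp
    have h2 := hasGradientAt_comp_norm_sub_sq (a := q.1) (x := x)
      ((((hasDerivAt_id (‖x - q.1‖ ^ 2)).add_const (‖u - q.2.1‖ ^ 2)).add_const
          ((t - q.2.2) ^ 2)).const_mul k)
    convert hasGradientAt_add h1 h2 using 3
    · simp [conePenalty]
    · simp [sqDist]
    · simp [hg, conePenalty, hρ]; field_simp
    · simp
  have hu : HasGradientAt
      (fun u => conePenalty N L c x₀ u₀ (x, u, t) + k * sqDist (x, u, t) q)
      ((N * g / ρ) • (u - u₀) + (2 * k) • (u - q.2.1)) u := by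
    have h1 := hasGradientAt_comp_norm_sub_sq (a := u₀) (x := u)
      ((((((hasDerivAt_id (‖u - u₀‖ ^ 2)).const_add (1 + ‖x - x₀‖ ^ 2)).sqrt
        hpos.ne').sub_const (L * t)).sub_const c).const_mul N).exp
    have h2 := hasGradientAt_comp_norm_sub_sq (a := q.2.1) (x := u)
      ((((hasDerivAt_id (‖u - q.2.1‖ ^ 2)).const_add (‖x - q.1‖ ^ 2)).add_const
          ((t - q.2.2) ^ 2)).const_mul k)
    convert hasGradientAt_add h1 h2 using 3
    · simp [conePenalty]
    · simp [sqDist]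
    · simp [hg, conePenalty, hρ]; field_simp
    · simp
  rw [hjbExpr, ht.deriv, hx.gradient, hu.gradient]
  have hNg : 0 ≤ N * g := by positivity
  have hxn : ‖(N * g / ρ) • (x - x₀)‖ ≤ N * g := by
    rw [norm_smul, Real.norm_of_nonneg (by positivity), div_mul_eq_mul_div, div_le_iff₀ hρ0]
    exact mul_le_mul_of_nonneg_left (Real.le_sqrt_of_sq_le (by nlinarith [sq_nonneg ‖u - u₀‖])) hNg
  have hun : ‖(N * g / ρ) • (u - u₀)‖ ≤ N * g := by
    rw [norm_smul, Real.norm_of_nonneg (by positivity), div_mul_eq_mul_div, div_le_iff₀ hρ0]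
    exact mul_le_mul_of_nonneg_left (Real.le_sqrt_of_sq_le (by nlinarith [sq_nonneg ‖x - x₀‖])) hNg
  have h1 : ⟪(N * g / ρ) • (x - x₀), f x u⟫ ≤ N * g * Cf :=
    (real_inner_le_norm _ _).trans (mul_le_mul hxn (hfb x u) (norm_nonneg _) hNg)
  have h2 : M * ‖(2 * k) • (u - q.2.1)‖ ≤
      M * ‖(N * g / ρ) • (u - u₀) + (2 * k) • (u - q.2.1)‖ + M * (N * g) := by
    rw [← mul_add]
    refine mul_le_mul_of_nonneg_left ?_ hM
    have := norm_sub_le ((N * g / ρ) • (u - u₀) + (2 * k) • (u - q.2.1)) ((N * g / ρ) • (u - u₀))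
    rw [add_sub_cancel_left] at this
    linarith
  rw [inner_add_left, hL]
  linarith

end Derivatives

theorem sqDist_eq_zero_imp {E F : Type*} [NormedAddCommGroup E] [NormedAddCommGroup F]
    {p q : E × F × ℝ} (h : sqDist p q = 0) : p = q := by
  have h1 := sq_nonneg ‖p.1 - q.1‖
  have h2 := sq_nonneg ‖p.2.1 - q.2.1‖
  have h3 := sq_nonneg (p.2.2 - q.2.2)
  simp only [sqDist] at h
  have e1 : ‖p.1 - q.1‖ ^ 2 = 0 := by linarith
  have e2 : ‖p.2.1 - q.2.1‖ ^ 2 = 0 := by linarith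
  have e3 : (p.2.2 - q.2.2) ^ 2 = 0 := by linarith
  rw [sq_eq_zero_iff, norm_eq_zero, sub_eq_zero] at e1 e2
  rw [sq_eq_zero_iff, sub_eq_zero] at e3
  exact Prod.ext e1 (Prod.ext e2 e3)

/-- The space coordinates of a pair of points contribute at most `sqDist` to the increment of a
Lipschitz drift paired with the gradient of the doubling penalty. -/
theorem inner_sub_drift_le {n m : ℕ}
    {f : EuclideanSpace ℝ (Fin n) → EuclideanSpace ℝ (Fin m) → EuclideanSpace ℝ (Fin n)}
    {Kf : NNReal}
    (hfl : LipschitzWith Kf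
      (fun p : EuclideanSpace ℝ (Fin n) × EuclideanSpace ℝ (Fin m) => f p.1 p.2))
    {k : ℝ} (hk : 0 ≤ k) (p q : EuclideanSpace ℝ (Fin n) × EuclideanSpace ℝ (Fin m) × ℝ) :
    ⟪(2 * k) • (p.1 - q.1), f p.1 p.2.1⟫ - ⟪(2 * k) • (p.1 - q.1), f q.1 q.2.1⟫ ≤
      2 * Kf * (k * sqDist p q) := by
  set d := max ‖p.1 - q.1‖ ‖p.2.1 - q.2.1‖ with hd
  have hd0 : 0 ≤ d := (norm_nonneg _).trans (le_max_left _ _)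
  have hf : ‖f p.1 p.2.1 - f q.1 q.2.1‖ ≤ Kf * d := by
    have := hfl.dist_le_mul (p.1, p.2.1) (q.1, q.2.1)
    rwa [dist_eq_norm, Prod.dist_eq, dist_eq_norm, dist_eq_norm] at this
  have hdsq : d ^ 2 ≤ sqDist p q := by
    have h1 := sq_nonneg ‖p.1 - q.1‖
    have h2 := sq_nonneg ‖p.2.1 - q.2.1‖
    have h3 := sq_nonneg (p.2.2 - q.2.2)
    rcases max_choice ‖p.1 - q.1‖ ‖p.2.1 - q.2.1‖ with h | h <;> rw [hd, h, sqDist] <;> linarith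
  rw [← inner_sub_right]
  calc ⟪(2 * k) • (p.1 - q.1), f p.1 p.2.1 - f q.1 q.2.1⟫
      ≤ ‖(2 * k) • (p.1 - q.1)‖ * ‖f p.1 p.2.1 - f q.1 q.2.1‖ := real_inner_le_norm _ _
    _ ≤ (2 * k * d) * (Kf * d) := by
        refine mul_le_mul ?_ hf (norm_nonneg _) (by positivity)
        rw [norm_smul, Real.norm_of_nonneg (by positivity)]
        exact mul_le_mul_of_nonneg_left (le_max_left _ _) (by positivity)
    _ = 2 * Kf * (k * d ^ 2) := by ring
    _ ≤ _ := by gcongr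

/-- On the lateral and initial boundary of a cylinder around `(x₀, u₀, t₀)` the exponent of the
cone penalty stays above its value at the apex by a fixed amount. -/
theorem cone_exponent_ge {E F : Type*} [NormedAddCommGroup E] [NormedAddCommGroup F]
    {L T t₀ : ℝ} (hL : 0 < L) (ht₀ : 0 < t₀) {x₀ x : E} {u₀ u : F} {t : ℝ} (ht : t ≤ T)
    (h : 2 + L * T ≤ ‖x - x₀‖ ∨ 2 + L * T ≤ ‖u - u₀‖ ∨ t ≤ t₀ / 2) :
    1 + min 1 (L * t₀ / 2) ≤ √(1 + ‖x - x₀‖ ^ 2 + ‖u - u₀‖ ^ 2) - L * t + L * t₀ := by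
  have hx : ‖x - x₀‖ ≤ √(1 + ‖x - x₀‖ ^ 2 + ‖u - u₀‖ ^ 2) :=
    Real.le_sqrt_of_sq_le (by nlinarith [sq_nonneg ‖u - u₀‖])
  have hu : ‖u - u₀‖ ≤ √(1 + ‖x - x₀‖ ^ 2 + ‖u - u₀‖ ^ 2) :=
    Real.le_sqrt_of_sq_le (by nlinarith [sq_nonneg ‖x - x₀‖])
  have h1 : 1 ≤ √(1 + ‖x - x₀‖ ^ 2 + ‖u - u₀‖ ^ 2) :=
    Real.le_sqrt_of_sq_le (by nlinarith [sq_nonneg ‖u - u₀‖, sq_nonneg ‖x - x₀‖])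
  have hLt : L * t ≤ L * T := mul_le_mul_of_nonneg_left ht hL.le
  have hLt₀ : 0 < L * t₀ := mul_pos hL ht₀
  have hm1 := min_le_left 1 (L * t₀ / 2)
  have hm2 := min_le_right 1 (L * t₀ / 2)
  rcases h with h | h | h
  · linarith
  · linarith
  · have := mul_le_mul_of_nonneg_left h hL.le
    linarith

/-- Comparison at interior times. -/
theorem IsViscositySolution.le_of_mem_Ioo {n m : ℕ}
    {f : EuclideanSpace ℝ (Fin n) → EuclideanSpace ℝ (Fin m) → EuclideanSpace ℝ (Fin n)}
    {r : EuclideanSpace ℝ (Fin n) → EuclideanSpace ℝ (Fin m) → ℝ}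
    {q : EuclideanSpace ℝ (Fin n) → ℝ} {M T : ℝ} (hM : 0 < M) {Cf : ℝ}
    (hfb : ∀ x u, ‖f x u‖ ≤ Cf) {Kf Kr : NNReal}
    (hfl : LipschitzWith Kf
      (fun p : EuclideanSpace ℝ (Fin n) × EuclideanSpace ℝ (Fin m) => f p.1 p.2))
    (hrl : LipschitzWith Kr
      (fun p : EuclideanSpace ℝ (Fin n) × EuclideanSpace ℝ (Fin m) => r p.1 p.2))
    {Q₁ Q₂ : EuclideanSpace ℝ (Fin n) × EuclideanSpace ℝ (Fin m) × ℝ → ℝ}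
    (hQ₁ : IsViscositySolution f r q M T Q₁) (hQ₂ : IsViscositySolution f r q M T Q₂)
    (x₀ : EuclideanSpace ℝ (Fin n)) (u₀ : EuclideanSpace ℝ (Fin m)) {t₀ : ℝ}
    (ht₀ : t₀ ∈ Set.Ioo 0 T) : Q₁ (x₀, u₀, t₀) ≤ Q₂ (x₀, u₀, t₀) := by
  obtain ⟨hc₁, hT₁, hsub, -⟩ := hQ₁
  obtain ⟨hc₂, hT₂, -, hsup⟩ := hQ₂
  by_contra! hlt
  obtain ⟨w, hw, hw0⟩ : ∃ w, w = Q₁ (x₀, u₀, t₀) - Q₂ (x₀, u₀, t₀) ∧ 0 < w :=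
    ⟨_, rfl, sub_pos.2 hlt⟩
  have hCf : 0 ≤ Cf := (norm_nonneg _).trans (hfb x₀ u₀)
  obtain ⟨L, hL⟩ : ∃ L, L = Cf + M + 1 := ⟨_, rfl⟩
  have hL0 : 0 < L := by linarith
  have hT : 0 < T := ht₀.1.trans ht₀.2
  have hLT : 0 < L * T := mul_pos hL0 hT
  obtain ⟨ht₀0, ht₀T⟩ := ht₀
  set K := Metric.closedBall x₀ (2 + L * T) ×ˢ Metric.closedBall u₀ (2 + L * T) ×ˢ
    Set.Icc (t₀ / 2) T with hKdef
  have hK : IsCompact K := (isCompact_closedBall _ _).prod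
    ((isCompact_closedBall _ _).prod isCompact_Icc)
  have hp₀K : (x₀, u₀, t₀) ∈ K :=
    ⟨Metric.mem_closedBall_self (by positivity), Metric.mem_closedBall_self (by positivity),
      by linarith, ht₀T.le⟩
  have hKsub : K ⊆ Set.univ ×ˢ Set.univ ×ˢ Set.Icc 0 T := fun p hp =>
    ⟨trivial, trivial, by linarith [hp.2.2.1], hp.2.2.2⟩
  have hcK₁ := hc₁.mono hKsub
  have hcK₂ := hc₂.mono hKsub
  obtain ⟨B, hB⟩ := (hK.image_of_continuousOn (hcK₁.sub hcK₂)).bddAbove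
  have hB' : ∀ p ∈ K, Q₁ p - Q₂ p ≤ B := fun p hp => hB ⟨p, hp, rfl⟩
  obtain ⟨θ, hθ⟩ : ∃ θ, θ = min 1 (L * t₀ / 2) := ⟨_, rfl⟩
  have hθ0 : 0 < θ := by rw [hθ]; exact lt_min one_pos (by positivity)
  obtain ⟨N, hN0, hNB⟩ : ∃ N : ℝ, 0 < N ∧ max B w⁻¹ < Real.exp (N * (θ / 2)) := by
    have h : Filter.Tendsto (fun N : ℝ => Real.exp (N * (θ / 2))) Filter.atTop Filter.atTop :=
      Real.tendsto_exp_atTop.comp (Filter.tendsto_id.atTop_mul_const (by positivity))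
    exact ((Filter.eventually_gt_atTop 0).and (h.eventually_gt_atTop _)).exists
  obtain ⟨hNB, hNw⟩ := max_lt_iff.1 hNB
  obtain ⟨c, hc⟩ : ∃ c, c = 1 - L * t₀ + θ / 2 := ⟨_, rfl⟩
  set g := conePenalty N L c x₀ u₀ with hg
  have hgC : ContDiff ℝ 1 g := contDiff_conePenalty N L c x₀ u₀
  have hg₀ : g (x₀, u₀, t₀) < w := by
    have : g (x₀, u₀, t₀) = (Real.exp (N * (θ / 2)))⁻¹ := by
      rw [← Real.exp_neg]
      simp [hg, conePenalty, hc]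
    rw [this]
    exact inv_lt_of_inv_lt₀ hw0 hNw
  obtain ⟨z, hzK, hzmax, hdbl⟩ := exists_doubled_max_near hK ⟨_, hp₀K⟩
    (hcK₁.sub hgC.continuous.continuousOn) hcK₂
    (φ := fun w => sqDist w.1 w.2) (by unfold sqDist; fun_prop)
    (fun p => by unfold sqDist; positivity) (fun p => by simp [sqDist])
    (fun p q h => sqDist_eq_zero_imp h)
  have hz0 : 0 < Q₁ z - g z - Q₂ z := by
    have := hzmax _ hp₀K
    simp only [Pi.sub_apply] at this
    linarith
  set U := Metric.ball x₀ (2 + L * T) ×ˢ Metric.ball u₀ (2 + L * T) ×ˢ Set.Ioo (t₀ / 2) T with hU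
  have hUo : IsOpen U := Metric.isOpen_ball.prod (Metric.isOpen_ball.prod isOpen_Ioo)
  have hUK : U ⊆ K := Set.prod_mono Metric.ball_subset_closedBall
    (Set.prod_mono Metric.ball_subset_closedBall Set.Ioo_subset_Icc_self)
  have hzT : z.2.2 < T := by
    refine lt_of_le_of_ne hzK.2.2.2 fun h => ?_
    have e : z = (z.1, z.2.1, T) := by rw [← h]
    have h1 : Q₁ z = q z.1 := by rw [e]; exact hT₁ _ _
    have h2 : Q₂ z = q z.1 := by rw [e]; exact hT₂ _ _
    have h3 : 0 < g z := Real.exp_pos _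
    linarith
  have hzU : z ∈ U := by
    by_contra hz
    have hor : 2 + L * T ≤ ‖z.1 - x₀‖ ∨ 2 + L * T ≤ ‖z.2.1 - u₀‖ ∨ z.2.2 ≤ t₀ / 2 := by
      by_contra! h
      exact hz ⟨by simpa [dist_eq_norm] using h.1, by simpa [dist_eq_norm] using h.2.1, h.2.2, hzT⟩
    have h1 := cone_exponent_ge hL0 ht₀0 hzT.le hor
    rw [← hθ] at h1
    have h2 : Real.exp (N * (θ / 2)) ≤ g z :=
      Real.exp_le_exp.2 (mul_le_mul_of_nonneg_left (by linarith) hN0.le)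
    linarith [hB' z hzK]
  obtain ⟨γ, hγ⟩ : ∃ γ, γ = N * Real.exp (N * (1 - L * T - c)) := ⟨_, rfl⟩
  have hγ0 : 0 < γ := by rw [hγ]; positivity
  have hgγ : ∀ p ∈ U, γ ≤ N * g p := by
    intro p hp
    rw [hγ]
    refine mul_le_mul_of_nonneg_left (Real.exp_le_exp.2 (mul_le_mul_of_nonneg_left ?_ hN0.le))
      hN0.le
    have h1 : 1 ≤ √(1 + ‖p.1 - x₀‖ ^ 2 + ‖p.2.1 - u₀‖ ^ 2) :=
      Real.le_sqrt_of_sq_le (by nlinarith [sq_nonneg ‖p.1 - x₀‖, sq_nonneg ‖p.2.1 - u₀‖])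
    have h2 := mul_le_mul_of_nonneg_left hp.2.2.2.le hL0.le
    linarith
  obtain ⟨k, hk, p, hp, p', hp', hkφ, hmax⟩ := hdbl
    (U ∩ Metric.ball z (γ / (8 * (Kr + 1))))
    (Filter.inter_mem (hUo.mem_nhds hzU) (Metric.ball_mem_nhds _ (by positivity)))
    (γ / (4 * (Kf + 1))) (by positivity)
  have htp : p.2.2 ∈ Set.Ioo 0 T := ⟨by linarith [hp.1.2.2.1], hp.1.2.2.2⟩
  have htp' : p'.2.2 ∈ Set.Ioo 0 T := ⟨by linarith [hp'.1.2.2.1], hp'.1.2.2.2⟩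
  have h1 := hsub (fun a => g a + k * sqDist a p')
    (hgC.add (contDiff_const.mul (contDiff_sqDist_left p'))).contDiffOn p.1 p.2.1 p.2.2 htp (by
      filter_upwards [mem_nhdsWithin_of_mem_nhds (hUo.mem_nhds hp.1)] with a ha
      have := hmax a (hUK ha) p' (hUK hp'.1)
      simp only [Pi.sub_apply] at this ⊢
      linarith)
  have h2 := hsup (fun a => -(k * sqDist p a))
    (by
      simp only [sqDist_comm p]
      exact (contDiff_const.mul (contDiff_sqDist_left p)).neg.contDiffOn)
    p'.1 p'.2.1 p'.2.2 htp' (by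
      filter_upwards [mem_nhdsWithin_of_mem_nhds (hUo.mem_nhds hp'.1)] with a ha
      have := hmax p (hUK hp.1) a (hUK ha)
      simp only [Pi.sub_apply] at this ⊢
      linarith)
  rw [hjbExpr_neg_sqDist] at h2
  have h3 := h1.trans (hL ▸ hjbExpr_conePenalty_add_sqDist_le f r hM.le hfb hN0.le c k x₀ u₀ p'
    p.1 p.2.1 p.2.2)
  have h4 := inner_sub_drift_le hfl hk p p'
  have h5 := hgγ p hp.1
  have h6 : 2 * Kf * (k * sqDist p p') ≤ γ / 2 := by
    calc 2 * Kf * (k * sqDist p p') ≤ 2 * Kf * (γ / (4 * (Kf + 1))) := by gcongr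
      _ ≤ 2 * (Kf + 1) * (γ / (4 * (Kf + 1))) := by gcongr; simp
      _ = γ / 2 := by field_simp; norm_num
  have h7 : r p.1 p.2.1 - r p'.1 p'.2.1 ≤ γ / 4 := by
    have hd : dist p p' ≤ γ / (4 * (Kr + 1)) :=
      calc dist p p' ≤ dist p z + dist p' z := dist_triangle_right _ _ _
        _ ≤ γ / (8 * (Kr + 1)) + γ / (8 * (Kr + 1)) := add_le_add hp.2.le hp'.2.le
        _ = γ / (4 * (Kr + 1)) := by field_simp; norm_num
    have hd' : dist (p.1, p.2.1) (p'.1, p'.2.1) ≤ dist p p' :=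
      max_le_max le_rfl (le_max_left _ _)
    calc r p.1 p.2.1 - r p'.1 p'.2.1 ≤ Kr * dist (p.1, p.2.1) (p'.1, p'.2.1) :=
          (le_abs_self _).trans (hrl.dist_le_mul (p.1, p.2.1) (p'.1, p'.2.1))
      _ ≤ (Kr + 1) * (γ / (4 * (Kr + 1))) :=
          mul_le_mul (by simp) (hd'.trans hd) dist_nonneg (by positivity)
      _ = γ / 4 := by field_simp
  change _ ≤ N * conePenalty N L c x₀ u₀ (p.1, p.2.1, p.2.2) at h5
  linarith

/-- **Theorem 1 (uniqueness part)**: under (A1) and (A2), the viscosity solution of the HJB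
equation `∂_t Q + ∇ₓQ · f − M|∇ᵤQ| + r = 0` with terminal condition `Q(x,u,T) = q(x)` is
unique: any two viscosity solutions agree on `ℝⁿ × ℝᵐ × [0, T]`. -/
theorem viscositySolution_unique {n m : ℕ}
    (f : EuclideanSpace ℝ (Fin n) → EuclideanSpace ℝ (Fin m) → EuclideanSpace ℝ (Fin n))
    (r : EuclideanSpace ℝ (Fin n) → EuclideanSpace ℝ (Fin m) → ℝ)
    (q : EuclideanSpace ℝ (Fin n) → ℝ) (M T : ℝ) (hM : 0 < M) (hT : 0 < T)
    (Cf Cr Cq : ℝ)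
    (hfb : ∀ x u, ‖f x u‖ ≤ Cf) (hrb : ∀ x u, |r x u| ≤ Cr) (hqb : ∀ x, |q x| ≤ Cq)
    (Kf Kr Kq : NNReal)
    (hfl : LipschitzWith Kf (fun p : EuclideanSpace ℝ (Fin n) × EuclideanSpace ℝ (Fin m) => f p.1 p.2))
    (hrl : LipschitzWith Kr (fun p : EuclideanSpace ℝ (Fin n) × EuclideanSpace ℝ (Fin m) => r p.1 p.2))
    (hql : LipschitzWith Kq q)
    (Q₁ Q₂ : EuclideanSpace ℝ (Fin n) × EuclideanSpace ℝ (Fin m) × ℝ → ℝ)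
    (hQ₁ : IsViscositySolution f r q M T Q₁) (hQ₂ : IsViscositySolution f r q M T Q₂) :
    ∀ (x : EuclideanSpace ℝ (Fin n)) (u : EuclideanSpace ℝ (Fin m)) (t : ℝ),
      t ∈ Set.Icc 0 T → Q₁ (x, u, t) = Q₂ (x, u, t) := by
  intro x u t ht
  have hcont {Q : EuclideanSpace ℝ (Fin n) × EuclideanSpace ℝ (Fin m) × ℝ → ℝ}
      (hQ : IsViscositySolution f r q M T Q) :
      ContinuousOn (fun s => Q (x, u, s)) (Set.Icc 0 T) :=
    hQ.1.comp (by fun_prop) fun s hs => ⟨trivial, trivial, hs⟩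
  have hEq : Set.EqOn (fun s => Q₁ (x, u, s)) (fun s => Q₂ (x, u, s)) (Set.Ioo 0 T) :=
    fun s hs => le_antisymm (hQ₁.le_of_mem_Ioo hM hfb hfl hrl hQ₂ x u hs)
      (hQ₂.le_of_mem_Ioo hM hfb hfl hrl hQ₁ x u hs)
  exact hEq.of_subset_closure (hcont hQ₁) (hcont hQ₂) Set.Ioo_subset_Icc_self
    (closure_Ioo hT.ne).ge ht

end
end
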